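/- Let r, c ≥ 1 and n = rc. The image of the map SYT^stacked(2r×c) → S_{2n}, S ↦ prom_r(S), is precisely the set of fixed-point-free involutions ρ ∈ S_{2n} such that every 2-cycle (a b) of ρ has a ∈ {1,…,n} and b ∈ {n+1,…,2n}, the crossing number of ρ is r, and the nesting number of ρ is c. -/

import Mathlib

namespace PromRS

/-! ## Rectangular standard Young tableaux (as functions; 0-indexed cells; entries 1..R*C) -/

/-- `T` is a standard Young tableau of rectangular shape with `R` rows and `C` columns:
rows and columns strictly increase, and the entries on the `R × C` rectangle are a
bijection onto `{1, …, R*C}`. -/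
def IsSYT (R C : ℕ) (T : ℕ → ℕ → ℕ) : Prop :=
  (∀ i j, i < R → j + 1 < C → T i j < T i (j + 1)) ∧
  (∀ i j, i + 1 < R → j < C → T i j < T (i + 1) j) ∧
  Set.BijOn (fun p : ℕ × ℕ => T p.1 p.2) {p : ℕ × ℕ | p.1 < R ∧ p.2 < C} (Set.Icc 1 (R * C))

/-- Stacking: add `r*c` to every entry of `Q` and place the result below `P`. -/
def stack (r c : ℕ) (P Q : ℕ → ℕ → ℕ) : ℕ → ℕ → ℕ := fun i j =>
  if i < r then P i j else Q (i - r) j + r * c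

/-! ## Gromotion and promotion permutations -/

/-- Value of `T` at a cell, with `⊤` outside the `R × C` rectangle. -/
def ext (R C : ℕ) (T : ℕ → ℕ → ℕ) (p : ℕ × ℕ) : WithTop ℕ :=
  if p.1 < R ∧ p.2 < C then ((T p.1 p.2 : ℕ) : WithTop ℕ) else ⊤

/-- The jeu de taquin slide moves the empty cell to the smaller of its east/south neighbors. -/
def nextCell (R C : ℕ) (T : ℕ → ℕ → ℕ) (p : ℕ × ℕ) : ℕ × ℕ :=
  if ext R C T (p.1, p.2 + 1) < ext R C T (p.1 + 1, p.2) then (p.1, p.2 + 1)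
  else (p.1 + 1, p.2)

/-- The sliding path of the empty cell, starting at the top-left corner. -/
def slidePath (R C : ℕ) (T : ℕ → ℕ → ℕ) : ℕ → ℕ × ℕ
  | 0 => (0, 0)
  | k + 1 => nextCell R C T (slidePath R C T k)

def maxEntry (R C : ℕ) (T : ℕ → ℕ → ℕ) : ℕ :=
  ((Finset.range R) ×ˢ (Finset.range C)).sup fun p => T p.1 p.2

/-- Gromotion: delete the minimal entry (at the top-left corner), rectify by jeu de taquin
slides, and fill the vacated outer corner with (current maximum) + 1; entries are not
decremented. -/
def gromotion (R C : ℕ) (T : ℕ → ℕ → ℕ) : ℕ → ℕ → ℕ := fun i j =>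
  if i = R - 1 ∧ j = C - 1 then maxEntry R C T + 1
  else
    match (List.range (R + C - 2)).find? (fun k => decide (slidePath R C T k = (i, j))) with
    | some k => T (slidePath R C T (k + 1)).1 (slidePath R C T (k + 1)).2
    | none => T i j

/-- The entry that slides (up) into row `i` (1-indexed) during one gromotion slide of `T`:
the value of `T` at the first cell of the sliding path lying in 0-indexed row `i`. -/
def slideInto (R C : ℕ) (T : ℕ → ℕ → ℕ) (i : ℕ) : ℕ :=
  match (List.range (R + C - 1)).find? (fun k => decide ((slidePath R C T k).1 = i)) with
  | some k => T (slidePath R C T k).1 (slidePath R C T k).2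
  | none => 0

/-- The `i`-th promotion permutation of `T ∈ SYT(R × C)`: its value at `j` is the entry
that slides into row `i` when computing `gromotion^j(T)`, taken modulo `R*C` with
residues in `{1, …, R*C}`. -/
def promPerm (R C : ℕ) (T : ℕ → ℕ → ℕ) (i : ℕ) : ℕ → ℕ := fun j =>
  (slideInto R C ((gromotion R C)^[j - 1] T) i - 1) % (R * C) + 1

/-! ## Tableaux as lists of rows, Robinson–Schensted insertion -/

/-- Entry of a list-of-rows tableau (0-indexed; `0` outside). -/
def entryL (T : List (List ℕ)) (i j : ℕ) : ℕ := (T.getD i []).getD j 0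

/-- Convert a function tableau on an `R × C` rectangle to a list of rows. -/
def toListT (R C : ℕ) (T : ℕ → ℕ → ℕ) : List (List ℕ) :=
  (List.range R).map fun i => (List.range C).map fun j => T i j

/-- Transpose (conjugate) of a list-of-rows tableau. -/
def transposeT (T : List (List ℕ)) : List (List ℕ) :=
  (List.range (T.getD 0 []).length).map fun j => T.filterMap fun row => row[j]?

/-- Shape (row lengths) of a list-of-rows tableau. -/
def shapeL (T : List (List ℕ)) : List ℕ := T.map List.length

/-- Standard Young tableau, as a list of rows: weakly decreasing nonempty row lengths,
rows and columns strictly increasing, and entries exactly `{1, …, N}` where `N` is the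
number of cells. -/
def IsSYTList (T : List (List ℕ)) : Prop :=
  (∀ i, i + 1 < T.length → (T.getD (i + 1) []).length ≤ (T.getD i []).length) ∧
  (∀ row ∈ T, row ≠ []) ∧
  (∀ i j, i < T.length → j + 1 < (T.getD i []).length → entryL T i j < entryL T i (j + 1)) ∧
  (∀ i j, i + 1 < T.length → j < (T.getD (i + 1) []).length →
    entryL T i j < entryL T (i + 1) j) ∧
  T.flatten.Nodup ∧ (∀ m, m ∈ T.flatten ↔ 1 ≤ m ∧ m ≤ T.flatten.length)

/-- Schensted row insertion of `x` into a tableau. -/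
def rowInsert : List (List ℕ) → ℕ → List (List ℕ)
  | [], x => [[x]]
  | r :: rs, x =>
    match r.dropWhile (fun y => decide (y < x)) with
    | [] => (r ++ [x]) :: rs
    | y :: bs => (r.takeWhile (fun y => decide (y < x)) ++ x :: bs) :: rowInsert rs y

/-- The (0-indexed) row where the shape grew when passing from `P` to `P'`. -/
def rowOfNewCell (P P' : List (List ℕ)) : ℕ :=
  ((List.range P'.length).find? fun i =>
    decide ((P'.getD i []).length ≠ (P.getD i []).length)).getD 0

def placeInRow (Q : List (List ℕ)) (r k : ℕ) : List (List ℕ) :=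
  if r < Q.length then Q.set r (Q.getD r [] ++ [k]) else Q ++ [[k]]

/-- The Robinson–Schensted correspondence: the pair (insertion tableau, recording tableau)
of a word. -/
def RS (w : List ℕ) : List (List ℕ) × List (List ℕ) :=
  (List.range w.length).foldl
    (fun PQ i =>
      let P' := rowInsert PQ.1 (w.getD i 0)
      (P', placeInRow PQ.2 (rowOfNewCell PQ.1 P') (i + 1)))
    ([], [])

/-! ## Jeu de taquin on list tableaux; evacuation -/

def extL (T : List (List ℕ)) (p : ℕ × ℕ) : WithTop ℕ :=
  if p.2 < (T.getD p.1 []).length then ((entryL T p.1 p.2 : ℕ) : WithTop ℕ) else ⊤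

def nextCellL (T : List (List ℕ)) (p : ℕ × ℕ) : ℕ × ℕ :=
  if extL T (p.1, p.2 + 1) = ⊤ ∧ extL T (p.1 + 1, p.2) = ⊤ then p
  else if extL T (p.1, p.2 + 1) < extL T (p.1 + 1, p.2) then (p.1, p.2 + 1)
  else (p.1 + 1, p.2)

def jdtPath (T : List (List ℕ)) : ℕ → ℕ × ℕ
  | 0 => (0, 0)
  | k + 1 => nextCellL T (jdtPath T k)

/-- The outer corner vacated when the minimal entry of `T` is deleted and the tableau is
rectified by jeu de taquin slides. -/
def vacated (T : List (List ℕ)) : ℕ × ℕ := jdtPath T T.flatten.length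

/-- The value at cell `(i, j)` after the rectification slide. -/
def slidValue (T : List (List ℕ)) (i j : ℕ) : ℕ :=
  match (List.range T.flatten.length).find? (fun k =>
      decide (jdtPath T k = (i, j) ∧ jdtPath T (k + 1) ≠ (i, j))) with
  | some k => entryL T (jdtPath T (k + 1)).1 (jdtPath T (k + 1)).2
  | none => entryL T i j

/-- Delete the minimal entry of `T` and rectify. -/
def delta (T : List (List ℕ)) : List (List ℕ) :=
  ((List.range T.length).map fun i =>
    (List.range ((T.getD i []).length - if i = (vacated T).1 then 1 else 0)).map fun j =>
      slidValue T i j).filter fun row => decide (row ≠ [])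

/-- The entry of the evacuation `∂T` at cell `(i,j)`: `n + 1 - k` where the `k`-th
deletion-rectification vacates `(i,j)`. -/
def evacEntry (T : List (List ℕ)) (i j : ℕ) : ℕ :=
  match (List.range T.flatten.length).find? (fun k =>
      decide (vacated (delta^[k] T) = (i, j))) with
  | some k => T.flatten.length - k
  | none => 0

/-- Schützenberger evacuation `∂T` of a standard Young tableau. -/
def evacL (T : List (List ℕ)) : List (List ℕ) :=
  (List.range T.length).map fun i =>
    (List.range (T.getD i []).length).map fun j => evacEntry T i j

/-! ## Shadow lines, skeleta, and Viennot's construction -/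

def dirNE (a b : ℤ × ℤ) : Prop := a.1 ≤ b.1 ∧ a.2 ≤ b.2
def dirSE (a b : ℤ × ℤ) : Prop := a.1 ≤ b.1 ∧ b.2 ≤ a.2
def dirSW (a b : ℤ × ℤ) : Prop := b.1 ≤ a.1 ∧ b.2 ≤ a.2
def dirNW (a b : ℤ × ℤ) : Prop := b.1 ≤ a.1 ∧ a.2 ≤ b.2

def minimalsUnder (d : ℤ × ℤ → ℤ × ℤ → Prop) (P : Set (ℤ × ℤ)) : Set (ℤ × ℤ) :=
  {p ∈ P | ∀ q ∈ P, d q p → q = p}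

/-- `P` minus its first `j` shadow lines. -/
def shadowRest (d : ℤ × ℤ → ℤ × ℤ → Prop) (P : Set (ℤ × ℤ)) : ℕ → Set (ℤ × ℤ)
  | 0 => P
  | j + 1 => shadowRest d P j \ minimalsUnder d (shadowRest d P j)

/-- The `j`-th shadow line of `P` (1-indexed `j`). -/
def shadowLine (d : ℤ × ℤ → ℤ × ℤ → Prop) (P : Set (ℤ × ℤ)) (j : ℕ) : Set (ℤ × ℤ) :=
  minimalsUnder d (shadowRest d P (j - 1))

/-- The skeleton of a single shadow line `L`: the minimal elements of the set of points
covered by the shadows of at least two points of `L`. -/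
def lineSkeleton (d : ℤ × ℤ → ℤ × ℤ → Prop) (L : Set (ℤ × ℤ)) : Set (ℤ × ℤ) :=
  minimalsUnder d {x | ∃ p ∈ L, ∃ q ∈ L, p ≠ q ∧ d p x ∧ d q x}

/-- The skeleton of `P`: the union of the skeleta of its shadow lines. -/
def skeleton (d : ℤ × ℤ → ℤ × ℤ → Prop) (P : Set (ℤ × ℤ)) : Set (ℤ × ℤ) :=
  ⋃ j : ℕ, lineSkeleton d (shadowLine d P (j + 1))

/-- The `k`-th iterated skeleton of `P`. -/
def skeletonIter (d : ℤ × ℤ → ℤ × ℤ → Prop) (P : Set (ℤ × ℤ)) (k : ℕ) : Set (ℤ × ℤ) :=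
  (skeleton d)^[k] P

def IsMinSnd (L : Set (ℤ × ℤ)) (y : ℤ) : Prop := (∃ p ∈ L, p.2 = y) ∧ ∀ p ∈ L, y ≤ p.2
def IsMaxSnd (L : Set (ℤ × ℤ)) (y : ℤ) : Prop := (∃ p ∈ L, p.2 = y) ∧ ∀ p ∈ L, p.2 ≤ y
def IsMinFst (L : Set (ℤ × ℤ)) (x : ℤ) : Prop := (∃ p ∈ L, p.1 = x) ∧ ∀ p ∈ L, x ≤ p.1
def IsMaxFst (L : Set (ℤ × ℤ)) (x : ℤ) : Prop := (∃ p ∈ L, p.1 = x) ∧ ∀ p ∈ L, p.1 ≤ x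

/-- The set of exit coordinates (specified by `spec`) of the shadow lines of the `i`-th
iterated skeleton of `P` in direction `d`. -/
def exitSet (spec : Set (ℤ × ℤ) → ℤ → Prop) (d : ℤ × ℤ → ℤ × ℤ → Prop)
    (P : Set (ℤ × ℤ)) (i : ℕ) : Set ℤ :=
  {v | ∃ j : ℕ, spec (shadowLine d (skeletonIter d P i) (j + 1)) v}

/-- The word read off along one edge in Viennot's construction is the lattice word of the
standard tableau `T`: there is an enumeration `e` of all shadow-line exit coordinates,
in the order prescribed by `lt`, such that the `m`-th exit belongs to a shadow line of the
`i`-th iterated skeleton exactly when the entry `m` of `T` lies in row `i + 1`. -/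
def ReadsWord (spec : Set (ℤ × ℤ) → ℤ → Prop) (lt : ℤ → ℤ → Prop)
    (d : ℤ × ℤ → ℤ × ℤ → Prop) (P : Set (ℤ × ℤ)) (T : List (List ℕ)) : Prop :=
  ∃ e : Fin T.flatten.length → ℤ,
    (∀ a b : Fin T.flatten.length, a < b → lt (e a) (e b)) ∧
    (Set.range e = ⋃ i : ℕ, exitSet spec d P i) ∧
    ∀ (m : Fin T.flatten.length) (i : ℕ), e m ∈ exitSet spec d P i →
      (T.findIdx fun row => row.contains (m.1 + 1)) + 1 = i + 1

/-- `𝒱(𝒫, ↗) = (Pt, Qt)`: the P-word is read bottom-to-top along the right edge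
(east exit heights, which are the minimal `y`-coordinates of the lines), the Q-word
left-to-right along the top edge (north exits at minimal `x`-coordinates). -/
def ViennotNE (P : Set (ℤ × ℤ)) (Pt Qt : List (List ℕ)) : Prop :=
  ReadsWord IsMinSnd (· < ·) dirNE P Pt ∧ ReadsWord IsMinFst (· < ·) dirNE P Qt

/-- `𝒱(𝒫, ↘) = (Pt, Qt)`: P-word left-to-right along the bottom edge, Q-word
top-to-bottom along the right edge. -/
def ViennotSE (P : Set (ℤ × ℤ)) (Pt Qt : List (List ℕ)) : Prop :=
  ReadsWord IsMinFst (· < ·) dirSE P Pt ∧ ReadsWord IsMaxSnd (· > ·) dirSE P Qt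

/-- `𝒱(𝒫, ↙) = (Pt, Qt)`: P-word bottom-to-top along the left edge, Q-word
right-to-left along the bottom edge. -/
def ViennotSW (P : Set (ℤ × ℤ)) (Pt Qt : List (List ℕ)) : Prop :=
  ReadsWord IsMaxSnd (· < ·) dirSW P Pt ∧ ReadsWord IsMaxFst (· > ·) dirSW P Qt

/-- `𝒱(𝒫, ↖) = (Pt, Qt)`: P-word right-to-left along the top edge, Q-word
bottom-to-top along the left edge. -/
def ViennotNW (P : Set (ℤ × ℤ)) (Pt Qt : List (List ℕ)) : Prop :=
  ReadsWord IsMaxFst (· > ·) dirNW P Pt ∧ ReadsWord IsMinSnd (· < ·) dirNW P Qt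

/-- The point set `𝒫^NE(ρ)` of the northeast `n × n` block of the permutation matrix of
`ρ ∈ S_{2n}`, in Cartesian coordinates. -/
def pointsNE (n : ℕ) (f : ℕ → ℕ) : Set (ℤ × ℤ) :=
  {p | ∃ x : ℕ, 1 ≤ x ∧ x ≤ n ∧ n < f x ∧ p = ((f x : ℤ) - n, (n : ℤ) + 1 - x)}

/-! ## Crossings and nestings of perfect matchings -/

/-- The matching `{a, f a}` on `{1, …, N}` has a `k`-crossing:
blocks `{a₁ < b₁}, …, {a_k < b_k}` with `a₁ < ⋯ < a_k < b₁ < ⋯ < b_k`. -/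
def HasCrossing (f : ℕ → ℕ) (N k : ℕ) : Prop :=
  ∃ a b : Fin k → ℕ, StrictMono a ∧ StrictMono b ∧
    (∀ m, 1 ≤ a m ∧ b m ≤ N ∧ f (a m) = b m ∧ a m < b m) ∧
    ∀ m m' : Fin k, a m < b m'

/-- The matching `{a, f a}` on `{1, …, N}` has a `k`-nesting:
blocks `{a₁ < b₁}, …, {a_k < b_k}` with `a₁ < ⋯ < a_k < b_k < ⋯ < b₁`. -/
def HasNesting (f : ℕ → ℕ) (N k : ℕ) : Prop :=
  ∃ a b : Fin k → ℕ, StrictMono a ∧ StrictAnti b ∧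
    (∀ m, 1 ≤ a m ∧ b m ≤ N ∧ f (a m) = b m ∧ a m < b m) ∧
    ∀ m m' : Fin k, a m < b m'

/-! ## Local rules, the promotion–evacuation diagram, and the promotion matrix -/

/-- Partitions are encoded as lists of row lengths (fixed length, padded by zeros). -/
def sortDesc (l : List ℕ) : List ℕ := List.insertionSort (· ≥ ·) l

/-- The sequence `ν + κ - λ` (pointwise). -/
def ruleSeq (lam nu ka : List ℕ) : List ℕ :=
  List.zipWith (fun a b => a - b) (List.zipWith (· + ·) nu ka) lam

/-- The local rule: `μ = sort(ν + κ - λ)`. -/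
def localRule (lam nu ka : List ℕ) : List ℕ := sortDesc (ruleSeq lam nu ka)

/-- The decoration of a local rule square: `i` if `ν + κ - λ` fails to be sorted at rows
`i, i+1` (1-indexed), and `0` if no decoration is present. -/
def decoration (lam nu ka : List ℕ) : ℕ :=
  match (List.range (ruleSeq lam nu ka).length).find? (fun i =>
      decide ((ruleSeq lam nu ka).getD i 0 < (ruleSeq lam nu ka).getD (i + 1) 0)) with
  | some i => i + 1
  | none => 0

/-- Fill in the next row of the promotion–evacuation diagram from the previous row `prev`:
the new row starts with the empty partition at position `s` and continues by local rules. -/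
def nextRow (R : ℕ) (prev : ℕ → List ℕ) (s : ℕ) : ℕ → List ℕ
  | 0 => List.replicate R 0
  | x + 1 =>
    if x + 1 ≤ s then List.replicate R 0
    else localRule (prev x) (prev (x + 1)) (nextRow R prev s x)

/-- The `j`-th row of the promotion–evacuation diagram of `T ∈ SYT(R × C)`, as a function
of the column index (row `0` is the chain of `T`). -/
def PErow (R C : ℕ) (T : ℕ → ℕ → ℕ) : ℕ → ℕ → List ℕ
  | 0 => fun x => (List.range R).map fun i =>
      ((Finset.range C).filter fun j => T i j ≤ min x (R * C)).card
  | j + 1 => nextRow R (PErow R C T j) (j + 1)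

/-- For `S = stack(P, Q) ∈ SYT(2r × c)` and `n = r*c`, the `(n+1) × (n+1)` northeast block
of partitions `λ(x, y)` of `PEdiagram(S)` (Cartesian coordinates): `λ(x,y)` is the
diagram entry in row `n - y`, column `n + x`. -/
def lamBlock (r c : ℕ) (S : ℕ → ℕ → ℕ) (x y : ℕ) : List ℕ :=
  PErow (2 * r) c S (r * c - y) (r * c + x)

/-- The entry of `PM(S)^NE` at Cartesian coordinates `(x, y)`, `1 ≤ x, y ≤ n`: the
decoration of the local rule square with corners `λ(x-1, y-1)`, `λ(x-1, y)`, `λ(x, y-1)`,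
`λ(x, y)`. -/
def PMNE (r c : ℕ) (S : ℕ → ℕ → ℕ) (x y : ℕ) : ℕ :=
  decoration (lamBlock r c S (x - 1) y) (lamBlock r c S x y) (lamBlock r c S (x - 1) (y - 1))

/-- Chain of partitions of a list tableau: shape of the entries `≤ m`. -/
def chainOfL (T : List (List ℕ)) (m : ℕ) : List ℕ :=
  T.map fun row => (row.filter fun a => decide (a ≤ m)).length

/-- Column height `#{i : j < l i}` of a partition. -/
def colHeight (l : List ℕ) (j : ℕ) : ℕ := (l.filter fun a => decide (j < a)).length

/-- Vertical sum `l +' m` of two partitions (stack the columns of `m` onto those of `l`),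
computed inside a `rows × cols` bounding box. -/
def vsum (rows cols : ℕ) (l m : List ℕ) : List ℕ :=
  (List.range rows).map fun i =>
    ((List.range cols).filter fun j => decide (i < colHeight l j + colHeight m j)).length

/-! ## The point sets `S_k` and `S_{kj}` -/

/-- `x_{sj}`: the entry of `Q` in row `s`, column `j` (1-indexed). -/
def xEnt (Q : ℕ → ℕ → ℕ) (s j : ℕ) : ℤ := (Q (s - 1) (j - 1) : ℤ)

/-- `y_{tj}`: the entry of `∂(P)` in row `t`, column `j` (1-indexed). -/
def yEnt (r c : ℕ) (P : ℕ → ℕ → ℕ) (t j : ℕ) : ℤ :=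
  (entryL (evacL (toListT r c P)) (t - 1) (j - 1) : ℤ)

def Skj (r c : ℕ) (P Q : ℕ → ℕ → ℕ) (k j : ℕ) : Set (ℤ × ℤ) :=
  {p | ∃ s t : ℕ, 1 ≤ s ∧ s ≤ r ∧ 1 ≤ t ∧ t ≤ r ∧ s + t - 1 = k ∧
    p = (xEnt Q s j, yEnt r c P t j)}

def Sk (r c : ℕ) (P Q : ℕ → ℕ → ℕ) (k : ℕ) : Set (ℤ × ℤ) :=
  ⋃ j ∈ Set.Icc 1 c, Skj r c P Q k j

/-- A southeast chain of `k` ones in the matrix `U` (rows increase, columns increase),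
contained in a rectangle that fully fits into the strictly upper triangular part of the
`N × N` matrix. -/
def HasSEChain (U : ℕ → ℕ → ℕ) (N k : ℕ) : Prop :=
  ∃ a b : Fin k → ℕ, StrictMono a ∧ StrictMono b ∧ (∀ m, U (a m) (b m) = 1) ∧
    ∃ r₁ r₂ c₁ c₂ : ℕ, 1 ≤ r₁ ∧ r₂ < c₁ ∧ c₂ ≤ N ∧
      ∀ m, r₁ ≤ a m ∧ a m ≤ r₂ ∧ c₁ ≤ b m ∧ b m ≤ c₂

/-- A southwest chain of `k` ones in the matrix `U` (rows increase, columns decrease),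
contained in a rectangle that fully fits into the strictly upper triangular part of the
`N × N` matrix. -/
def HasSWChain (U : ℕ → ℕ → ℕ) (N k : ℕ) : Prop :=
  ∃ a b : Fin k → ℕ, StrictMono a ∧ StrictAnti b ∧ (∀ m, U (a m) (b m) = 1) ∧
    ∃ r₁ r₂ c₁ c₂ : ℕ, 1 ≤ r₁ ∧ r₂ < c₁ ∧ c₂ ≤ N ∧
      ∀ m, r₁ ≤ a m ∧ a m ≤ r₂ ∧ c₁ ≤ b m ∧ b m ≤ c₂

/-- Contents of two adjacent cells. -/
def Adj (a b : ℤ) : Prop := a = b + 1 ∨ b = a + 1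
instance (a b : ℤ) : Decidable (Adj a b) := inferInstanceAs (Decidable (_ ∨ _))

/-- The letter left behind when the hole of content `t` meets a letter of content `x`. -/
def stay (t x : ℤ) : ℤ := if Adj x t then t else x
/-- The content of the hole after meeting a letter of content `x`. -/
def carry (t x : ℤ) : ℤ := if Adj x t then x else t

theorem stay_carry (t x : ℤ) : ((x = t + 1 ∨ t = x + 1) ∧ stay t x = t ∧ carry t x = x) ∨
    (x ≠ t + 1 ∧ t ≠ x + 1 ∧ stay t x = x ∧ carry t x = t) := by
  unfold stay carry Adj
  split_ifs <;> omega

theorem stay_carry' (t x : ℤ) : ∃ s c, stay t x = s ∧ carry t x = c ∧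
    (((x = t + 1 ∨ t = x + 1) ∧ s = t ∧ c = x) ∨
    (x ≠ t + 1 ∧ t ≠ x + 1 ∧ s = x ∧ c = t)) := ⟨_, _, rfl, rfl, stay_carry t x⟩

/-- `a` lies strictly between `x` and `y`. -/
def Btw (a x y : ℤ) : Prop := (x < a ∧ a < y) ∨ (y < a ∧ a < x)
instance (a x y : ℤ) : Decidable (Btw a x y) := inferInstanceAs (Decidable (_ ∨ _))

/-- The first letter of the elementary dual equivalence move on `x, y, z`. -/
def dual1 (x y z : ℤ) : ℤ := if Btw x y z then x else if Btw z x y then y else x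
/-- The second letter of the elementary dual equivalence move on `x, y, z`. -/
def dual2 (x y z : ℤ) : ℤ := if Btw x y z then z else if Btw z x y then x else y
/-- The third letter of the elementary dual equivalence move on `x, y, z`. -/
def dual3 (x y z : ℤ) : ℤ := if Btw x y z then y else z

theorem dual_cases (x y z : ℤ) : ∃ a b c, dual1 x y z = a ∧ dual2 x y z = b ∧ dual3 x y z = c ∧
    ((((y < x ∧ x < z) ∨ (z < x ∧ x < y)) ∧ a = x ∧ b = z ∧ c = y) ∨
     (((x < z ∧ z < y) ∨ (y < z ∧ z < x)) ∧ a = y ∧ b = x ∧ c = z) ∨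
     (¬((y < x ∧ x < z) ∨ (z < x ∧ x < y)) ∧ ¬((x < z ∧ z < y) ∨ (y < z ∧ z < x)) ∧
        a = x ∧ b = y ∧ c = z)) := by
  refine ⟨_, _, _, rfl, rfl, rfl, ?_⟩
  unfold dual1 dual2 dual3 Btw
  split_ifs <;> omega

/-- A hole of content `t` followed by three letters of distinct contents, in a configuration that
occurs in standard fillings. -/
structure Quad (t x y z : ℤ) : Prop where
  tx : t ≠ x
  xy : x ≠ y
  yz : y ≠ z
  ty : t ≠ y
  xz : x ≠ z
  tz : t = z → (x = t + 1 ∧ y + 1 = t) ∨ (y = t + 1 ∧ x + 1 = t)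

theorem pair_slide {t x y : ℤ} (h1 : t ≠ x) (h2 : x ≠ y) (h3 : t ≠ y) :
    stay t x < stay (carry t x) y ↔ x < y := by
  unfold stay carry Adj
  split_ifs <;> omega

set_option maxHeartbeats 4000000 in
theorem Quad.slide {t x y z : ℤ} (h : Quad t x y z) :
    stay t (dual1 x y z) = dual1 (stay t x) (stay (carry t x) y) (stay (carry (carry t x) y) z) ∧
    stay (carry t (dual1 x y z)) (dual2 x y z) =
      dual2 (stay t x) (stay (carry t x) y) (stay (carry (carry t x) y) z) ∧
    stay (carry (carry t (dual1 x y z)) (dual2 x y z)) (dual3 x y z) =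
      dual3 (stay t x) (stay (carry t x) y) (stay (carry (carry t x) y) z) ∧
    carry (carry (carry t (dual1 x y z)) (dual2 x y z)) (dual3 x y z) =
      carry (carry (carry t x) y) z := by
  obtain ⟨h1, h2, h3, h4, h5, h6⟩ := h
  obtain ⟨s1, t1, e1, e2, H1⟩ := stay_carry' t x
  rw [e1, e2]; clear e1 e2
  obtain ⟨s2, t2, e1, e2, H2⟩ := stay_carry' t1 y
  rw [e1, e2]; clear e1 e2
  obtain ⟨s3, t3, e1, e2, H3⟩ := stay_carry' t2 z
  rw [e1, e2]; clear e1 e2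
  obtain ⟨a, b, c, e1, e2, e3, H⟩ := dual_cases x y z
  rw [e1, e2, e3]; clear e1 e2 e3
  obtain ⟨a', b', c', e1, e2, e3, H'⟩ := dual_cases s1 s2 s3
  rw [e1, e2, e3]; clear e1 e2 e3
  obtain ⟨s1', t1', e1, e2, H1'⟩ := stay_carry' t a
  rw [e1, e2]; clear e1 e2
  obtain ⟨s2', t2', e1, e2, H2'⟩ := stay_carry' t1' b
  rw [e1, e2]; clear e1 e2
  obtain ⟨s3', t3', e1, e2, H3'⟩ := stay_carry' t2' c
  rw [e1, e2]; clear e1 e2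
  rcases H1 with ⟨g1, rfl, rfl⟩ | ⟨g1, g1', rfl, rfl⟩ <;>
  rcases H2 with ⟨g2, rfl, rfl⟩ | ⟨g2, g2', rfl, rfl⟩ <;>
  rcases H3 with ⟨g3, rfl, rfl⟩ | ⟨g3, g3', rfl, rfl⟩ <;>
  rcases H with ⟨g4, rfl, rfl, rfl⟩ | ⟨g4, rfl, rfl, rfl⟩ | ⟨g4, g4', rfl, rfl, rfl⟩ <;>
  (try (exfalso; omega)) <;>
  rcases H' with ⟨g5, rfl, rfl, rfl⟩ | ⟨g5, rfl, rfl, rfl⟩ | ⟨g5, g5', rfl, rfl, rfl⟩ <;>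
  (try (exfalso; omega)) <;>
  rcases H1' with ⟨g1, rfl, rfl⟩ | ⟨g1, g1', rfl, rfl⟩ <;>
  (try (exfalso; omega)) <;>
  rcases H2' with ⟨g2, rfl, rfl⟩ | ⟨g2, g2', rfl, rfl⟩ <;>
  (try (exfalso; omega)) <;>
  rcases H3' with ⟨g3, rfl, rfl⟩ | ⟨g3, g3', rfl, rfl⟩ <;>
  omega

theorem stay_comm (t x : ℤ) : stay t x = carry x t := by
  unfold stay carry Adj; split_ifs <;> omega

theorem carry_comm (t x : ℤ) : carry t x = stay x t := (stay_comm x t).symm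

theorem stay_carry_add (φ : ℤ → ℤ) (t x : ℤ) : φ (stay t x) + φ (carry t x) = φ t + φ x := by
  unfold stay carry; split_ifs <;> ring

/-- The content of the sliding hole after the entries at positions `≤ m` have been met. -/
def hol (v : ℕ → ℤ) : ℕ → ℤ
  | 0 => v 0
  | m + 1 => carry (hol v m) (v (m + 1))

/-- The content vector after a promotion step. -/
def nxt (v : ℕ → ℤ) (m : ℕ) : ℤ := stay (hol v m) (v (m + 1))

/-- The contents vacated by successive promotion steps. -/
def ev (v : ℕ → ℤ) (L k : ℕ) : ℤ := hol (nxt^[k] v) (L - 1 - k)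

/-- Content vectors of standard fillings: first letter `0`, every later letter is adjacent to
an earlier one, and equal letters are separated by both adjacent letters. -/
structure Cont (L : ℕ) (v : ℕ → ℤ) : Prop where
  zero : 0 < L → v 0 = 0
  nbr : ∀ q, 0 < q → q < L → ∃ p < q, v p = v q + 1 ∨ v p = v q - 1
  sep : ∀ i j, i < j → j < L → v i = v j →
    (∃ p, i < p ∧ p < j ∧ v p = v i + 1) ∧ (∃ p, i < p ∧ p < j ∧ v p = v i - 1)

theorem Cont.congr {L : ℕ} {v w : ℕ → ℤ} (h : Cont L v) (e : ∀ i < L, w i = v i) : Cont L w where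
  zero hL := by rw [e 0 hL, h.zero hL]
  nbr q h0 hq := by
    obtain ⟨p, hp, H⟩ := h.nbr q h0 hq
    exact ⟨p, hp, by rwa [e p (hp.trans hq), e q hq]⟩
  sep i j hij hj H := by
    rw [e i (hij.trans hj), e j hj] at H
    obtain ⟨⟨p, h1, h2, h3⟩, ⟨q, h4, h5, h6⟩⟩ := h.sep i j hij hj H
    rw [e i (hij.trans hj)]
    exact ⟨⟨p, h1, h2, by rw [e p (h2.trans hj), h3]⟩, ⟨q, h4, h5, by rw [e q (h5.trans hj), h6]⟩⟩

theorem Cont.mono {L M : ℕ} {v : ℕ → ℤ} (h : Cont L v) (hM : M ≤ L) : Cont M v where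
  zero hL := h.zero (by omega)
  nbr q h0 hq := h.nbr q h0 (by omega)
  sep i j hij hj H := h.sep i j hij (by omega) H

/-- Transposition of `j` and `j + 1`. -/
def tr (j k : ℕ) : ℕ := if k = j then j + 1 else if k = j + 1 then j else k

theorem tr_cases (j k : ℕ) : (k = j ∧ tr j k = j + 1) ∨ (k = j + 1 ∧ tr j k = j) ∨
    (k ≠ j ∧ k ≠ j + 1 ∧ tr j k = k) := by
  unfold tr; split_ifs <;> omega

theorem tr_tr (j k : ℕ) : tr j (tr j k) = k := by
  unfold tr; split_ifs <;> omega

/-- Exchange of the letters at positions `j` and `j + 1`. -/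
def swp (j : ℕ) (v : ℕ → ℤ) (k : ℕ) : ℤ := v (tr j k)

theorem swp_left (j : ℕ) (v : ℕ → ℤ) : swp j v j = v (j + 1) := by simp [swp, tr]

theorem swp_right (j : ℕ) (v : ℕ → ℤ) : swp j v (j + 1) = v j := by simp [swp, tr]

theorem swp_of_ne {j k : ℕ} (v : ℕ → ℤ) (h : k ≠ j) (h' : k ≠ j + 1) : swp j v k = v k := by
  simp [swp, tr, h, h']

theorem swp_swp (j : ℕ) (v : ℕ → ℤ) : swp j (swp j v) = v := by
  funext k; simp [swp, tr_tr]

theorem Cont.ne_succ {L j : ℕ} {v : ℕ → ℤ} (h : Cont L v) (hj : j + 1 < L) : v j ≠ v (j + 1) := by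
  intro e
  obtain ⟨⟨p, h1, h2, -⟩, -⟩ := h.sep j (j + 1) (by omega) hj e
  omega

theorem Cont.ne_succ_succ {L j : ℕ} {v : ℕ → ℤ} (h : Cont L v) (hj : j + 2 < L) :
    v j ≠ v (j + 2) := by
  intro e
  obtain ⟨⟨p, h1, h2, h3⟩, ⟨q, h4, h5, h6⟩⟩ := h.sep j (j + 2) (by omega) hj e
  obtain rfl : p = q := by omega
  omega

theorem Cont.quad {L j : ℕ} {v : ℕ → ℤ} (h : Cont L v) (hj : j + 3 < L) :
    Quad (v j) (v (j + 1)) (v (j + 2)) (v (j + 3)) where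
  tx := h.ne_succ (by omega)
  xy := h.ne_succ (by omega)
  yz := h.ne_succ (by omega)
  ty := h.ne_succ_succ (by omega)
  xz := h.ne_succ_succ (by omega)
  tz e := by
    obtain ⟨⟨p, h1, h2, h3⟩, ⟨q, h4, h5, h6⟩⟩ := h.sep j (j + 3) (by omega) hj e
    have : (p = j + 1 ∧ q = j + 2) ∨ (p = j + 2 ∧ q = j + 1) := by
      have : p ≠ q := by rintro rfl; omega
      omega
    rcases this with ⟨rfl, rfl⟩ | ⟨rfl, rfl⟩
    · left; omega
    · right; omega

theorem Quad.symm {t x y z : ℤ} (h : Quad t x y z) : Quad z y x t := by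
  obtain ⟨h1, h2, h3, h4, h5, h6⟩ := h
  constructor <;> omega

theorem Cont.swp {L j : ℕ} {v : ℕ → ℤ} (h : Cont L v) (hj : j + 1 < L)
    (hA : ¬ Adj (v j) (v (j + 1))) : Cont L (swp j v) := by
  have hne := h.ne_succ hj
  unfold Adj at hA
  have key : ∀ a b, a < b → Adj (v a) (v b) ∨ v a = v b → tr j a < tr j b := by
    intro a b hab H
    rcases tr_cases j a with ⟨h1, h2⟩ | ⟨h1, h2⟩ | ⟨h1, h1', h2⟩ <;>
    rcases tr_cases j b with ⟨h3, h4⟩ | ⟨h3, h4⟩ | ⟨h3, h3', h4⟩ <;> try omega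
    unfold Adj at H
    subst h1 h3
    omega
  have hlt : ∀ a, a < L → tr j a < L := by
    intro a ha; rcases tr_cases j a with h | h | h <;> omega
  have hz : 0 < j := by
    rcases Nat.eq_zero_or_pos j with rfl | h'
    · obtain ⟨p, hp, H⟩ := h.nbr 1 (by omega) hj
      obtain rfl : p = 0 := by omega
      simp only [Nat.zero_add] at *
      omega
    · exact h'
  refine ⟨fun hL => ?_, fun q h0 hq => ?_, fun i k hik hk H => ?_⟩
  · rw [swp_of_ne _ (by omega) (by omega), h.zero hL]
  · obtain ⟨p, hp, H⟩ := h.nbr (tr j q) (by rcases tr_cases j q with h | h | h <;> omega) (hlt q hq)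
    refine ⟨tr j p, ?_, by simpa [PromRS.swp, tr_tr] using H⟩
    have := key p (tr j q) hp (Or.inl (by unfold Adj; omega))
    rwa [tr_tr] at this
  · have hne' : ¬ (i = j ∧ k = j + 1) := by
      rintro ⟨rfl, rfl⟩
      rw [swp_left, swp_right] at H
      exact hne H.symm
    have hlt' : tr j i < tr j k := by
      rcases tr_cases j i with ⟨h1, h2⟩ | ⟨h1, h2⟩ | ⟨h1, h1', h2⟩ <;>
      rcases tr_cases j k with ⟨h3, h4⟩ | ⟨h3, h4⟩ | ⟨h3, h3', h4⟩ <;> omega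
    obtain ⟨⟨p, h1, h2, h3⟩, ⟨q, h4, h5, h6⟩⟩ := h.sep _ _ hlt' (hlt k hk) H
    have e : v (tr j k) = v (tr j i) := H.symm
    refine ⟨⟨tr j p, ?_, ?_, by simpa [PromRS.swp, tr_tr] using h3⟩,
      ⟨tr j q, ?_, ?_, by simpa [PromRS.swp, tr_tr] using h6⟩⟩
    · have := key _ _ h1 (Or.inl (by unfold Adj; omega)); rwa [tr_tr] at this
    · have := key _ _ h2 (Or.inl (by unfold Adj; omega)); rwa [tr_tr] at this
    · have := key _ _ h4 (Or.inl (by unfold Adj; omega)); rwa [tr_tr] at this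
    · have := key _ _ h5 (Or.inl (by unfold Adj; omega)); rwa [tr_tr] at this

theorem sum_swp (φ : ℤ → ℤ) (v : ℕ → ℤ) {j s : ℕ} (hs : j + 1 < s) :
    ∑ k ∈ Finset.range s, φ (swp j v k) = ∑ k ∈ Finset.range s, φ (v k) := by
  refine Finset.sum_bij (fun k _ => tr j k) ?_ ?_ ?_ ?_
  · intro a ha
    rw [Finset.mem_range] at *
    rcases tr_cases j a with h | h | h <;> omega
  · intro a _ b _ hab
    rw [← tr_tr j a, hab, tr_tr]
  · intro b hb
    refine ⟨tr j b, ?_, tr_tr j b⟩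
    rw [Finset.mem_range] at *
    rcases tr_cases j b with h | h | h <;> omega
  · intro a _; rfl

/-- The partially slid content vector. -/
def slid (m : ℕ) (v : ℕ → ℤ) (i : ℕ) : ℤ :=
  if i < m then nxt v i else if i = m then hol v m else v i

theorem slid_of_lt {m i : ℕ} (v : ℕ → ℤ) (h : i < m) : slid m v i = nxt v i := by simp [slid, h]

theorem slid_self (m : ℕ) (v : ℕ → ℤ) : slid m v m = hol v m := by simp [slid]

theorem slid_of_gt {m i : ℕ} (v : ℕ → ℤ) (h : m < i) : slid m v i = v i := by
  simp [slid, h.not_gt, h.ne']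

theorem slid_zero (v : ℕ → ℤ) : slid 0 v = v := by
  funext i
  rcases Nat.eq_zero_or_pos i with rfl | h
  · rw [slid_self, hol]
  · rw [slid_of_gt v h]

theorem slid_succ (m : ℕ) (v : ℕ → ℤ) :
    slid (m + 1) v = if Adj (slid m v m) (slid m v (m + 1)) then slid m v
      else swp m (slid m v) := by
  rw [slid_self, slid_of_gt v (show m < m + 1 by omega)]
  have hs := stay_carry (hol v m) (v (m + 1))
  funext i
  rcases lt_trichotomy i m with h | rfl | h
  · rw [slid_of_lt v (by omega)]
    split_ifs
    · rw [slid_of_lt v h]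
    · rw [swp_of_ne _ (by omega) (by omega), slid_of_lt v h]
  · rw [slid_of_lt v (by omega), nxt]
    split_ifs with hA
    · rw [slid_self]; unfold Adj at hA; omega
    · rw [swp_left, slid_of_gt v (by omega)]; unfold Adj at hA; omega
  · rcases Nat.eq_or_lt_of_le h with rfl | h
    · rw [Nat.succ_eq_add_one, slid_self, hol]
      split_ifs with hA
      · rw [slid_of_gt v (by omega)]; unfold Adj at hA; omega
      · rw [swp_right, slid_self]; unfold Adj at hA; omega
    · rw [slid_of_gt v (by omega)]
      split_ifs
      · rw [slid_of_gt v (by omega)]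
      · rw [swp_of_ne _ (by omega) (by omega), slid_of_gt v (by omega)]

theorem Cont.slid {L : ℕ} {v : ℕ → ℤ} (h : Cont L v) {m : ℕ} (hm : m < L) : Cont L (slid m v) := by
  induction m with
  | zero => rwa [slid_zero]
  | succ m ih =>
    rw [slid_succ]
    split_ifs with hA
    · exact ih (by omega)
    · exact (ih (by omega)).swp hm hA

theorem Cont.nxt {L : ℕ} {v : ℕ → ℤ} (h : Cont (L + 1) v) : Cont L (nxt v) :=
  ((h.slid (m := L) (by omega)).mono (by omega)).congr fun i hi => (slid_of_lt v hi).symm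

theorem hol_congr {v w : ℕ → ℤ} {m : ℕ} (h : ∀ i ≤ m, v i = w i) : hol v m = hol w m := by
  induction m with
  | zero => exact h 0 le_rfl
  | succ m ih => rw [hol, hol, ih fun i hi => h i (by omega), h (m + 1) le_rfl]

theorem nxt_congr {v w : ℕ → ℤ} {m : ℕ} (h : ∀ i ≤ m + 1, v i = w i) : nxt v m = nxt w m := by
  rw [nxt, nxt, hol_congr fun i hi => h i (by omega), h (m + 1) le_rfl]

theorem nxt_iter_congr {v w : ℕ → ℤ} {k m : ℕ} (h : ∀ i ≤ m + k, v i = w i) :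
    nxt^[k] v m = nxt^[k] w m := by
  induction k generalizing m v w with
  | zero => exact h m le_rfl
  | succ k ih =>
    rw [Function.iterate_succ_apply, Function.iterate_succ_apply]
    exact ih fun i hi => nxt_congr fun j hj => h j (by omega)

theorem ev_congr {v w : ℕ → ℤ} {L k : ℕ} (hk : k < L) (h : ∀ i < L, v i = w i) :
    ev v L k = ev w L k :=
  hol_congr fun i hi => nxt_iter_congr fun j hj => h j (by omega)

theorem ev_zero (v : ℕ → ℤ) (L : ℕ) : ev v L 0 = hol v (L - 1) := rfl

theorem ev_succ (v : ℕ → ℤ) (L k : ℕ) : ev v (L + 1) (k + 1) = ev (nxt v) L k := by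
  unfold ev
  rw [Function.iterate_succ_apply]
  congr 1
  omega

theorem sum_nxt (φ : ℤ → ℤ) (v : ℕ → ℤ) (L : ℕ) :
    ∑ k ∈ Finset.range (L + 1), φ (v k) = ∑ k ∈ Finset.range L, φ (nxt v k) + φ (hol v L) := by
  induction L with
  | zero => simp [hol]
  | succ L ih =>
    rw [Finset.sum_range_succ, ih, Finset.sum_range_succ _ L, hol, nxt]
    have := stay_carry_add φ (hol v L) (v (L + 1))
    linarith

theorem sum_ev (φ : ℤ → ℤ) (v : ℕ → ℤ) (L : ℕ) :
    ∑ k ∈ Finset.range L, φ (ev v L k) = ∑ k ∈ Finset.range L, φ (v k) := by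
  induction L generalizing v with
  | zero => simp
  | succ L ih =>
    rw [Finset.sum_range_succ', sum_nxt, ev_zero, ← ih (nxt v)]
    simp only [ev_succ, Nat.add_sub_cancel]

/-- Elementary dual equivalence move on the letters `j, j + 1, j + 2`. -/
def dmv (j : ℕ) (v : ℕ → ℤ) : ℕ → ℤ :=
  if Btw (v j) (v (j + 1)) (v (j + 2)) then swp (j + 1) v
  else if Btw (v (j + 2)) (v j) (v (j + 1)) then swp j v else v

theorem dmv_apply_zero (j : ℕ) (v : ℕ → ℤ) :
    dmv j v j = dual1 (v j) (v (j + 1)) (v (j + 2)) := by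
  unfold dmv dual1
  split_ifs
  · rw [swp_of_ne _ (by omega) (by omega)]
  · rw [swp_left]
  · rfl

theorem dmv_apply_one (j : ℕ) (v : ℕ → ℤ) :
    dmv j v (j + 1) = dual2 (v j) (v (j + 1)) (v (j + 2)) := by
  unfold dmv dual2
  split_ifs
  · rw [swp_left]
  · rw [swp_right]
  · rfl

theorem dmv_apply_two (j : ℕ) (v : ℕ → ℤ) :
    dmv j v (j + 2) = dual3 (v j) (v (j + 1)) (v (j + 2)) := by
  unfold dmv dual3
  split_ifs
  · rw [swp_right (j + 1)]
  · rw [swp_of_ne _ (by omega) (by omega)]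
  · rfl

theorem dmv_apply_of_lt {j k : ℕ} (v : ℕ → ℤ) (h : k < j) : dmv j v k = v k := by
  unfold dmv
  split_ifs
  · rw [swp_of_ne _ (by omega) (by omega)]
  · rw [swp_of_ne _ (by omega) (by omega)]
  · rfl

theorem dmv_apply_of_gt {j k : ℕ} (v : ℕ → ℤ) (h : j + 2 < k) : dmv j v k = v k := by
  unfold dmv
  split_ifs
  · rw [swp_of_ne _ (by omega) (by omega)]
  · rw [swp_of_ne _ (by omega) (by omega)]
  · rfl

theorem dmv_congr {j L : ℕ} (hj : j + 2 < L) {v w : ℕ → ℤ} (h : ∀ i < L, v i = w i) :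
    ∀ i < L, dmv j v i = dmv j w i := by
  intro i hi
  have h0 := h j (by omega)
  have h1 := h (j + 1) (by omega)
  have h2 := h (j + 2) hj
  rcases lt_or_ge i j with hlt | hge
  · rw [dmv_apply_of_lt _ hlt, dmv_apply_of_lt _ hlt, h i hi]
  rcases lt_or_ge (j + 2) i with hlt | hge'
  · rw [dmv_apply_of_gt _ hlt, dmv_apply_of_gt _ hlt, h i hi]
  obtain rfl | rfl | rfl : i = j ∨ i = j + 1 ∨ i = j + 2 := by omega
  · rw [dmv_apply_zero, dmv_apply_zero, h0, h1, h2]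
  · rw [dmv_apply_one, dmv_apply_one, h0, h1, h2]
  · rw [dmv_apply_two, dmv_apply_two, h0, h1, h2]

theorem dmv_shift (j : ℕ) (v : ℕ → ℤ) (k : ℕ) :
    dmv (j + 1) v (k + 1) = dmv j (fun i => v (i + 1)) k := by
  rcases lt_or_ge k j with hlt | hge
  · rw [dmv_apply_of_lt _ hlt, dmv_apply_of_lt _ (by omega)]
  rcases lt_or_ge (j + 2) k with hlt | hge'
  · rw [dmv_apply_of_gt _ hlt, dmv_apply_of_gt _ (by omega)]
  obtain rfl | rfl | rfl : k = j ∨ k = j + 1 ∨ k = j + 2 := by omega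
  · rw [dmv_apply_zero, dmv_apply_zero]
  · rw [dmv_apply_one, dmv_apply_one]
  · rw [dmv_apply_two, dmv_apply_two]

theorem dmv_sub (κ : ℤ) (j : ℕ) (v : ℕ → ℤ) (k : ℕ) :
    dmv j (fun i => κ - v i) k = κ - dmv j v k := by
  have e1 : ∀ a b c : ℤ, Btw (κ - a) (κ - b) (κ - c) ↔ Btw a b c := by
    intro a b c; unfold Btw; omega
  unfold dmv
  simp only [e1]
  split_ifs <;> rfl

theorem dmv_dmv {L j : ℕ} {v : ℕ → ℤ} (h : Cont L v) (hj : j + 2 < L) : dmv j (dmv j v) = v := by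
  have h01 := h.ne_succ (j := j) (by omega)
  have h12 : v (j + 1) ≠ v (j + 2) := h.ne_succ (by omega)
  have h02 := h.ne_succ_succ hj
  have e1 := dmv_apply_zero j v
  have e2 := dmv_apply_one j v
  have e3 := dmv_apply_two j v
  obtain ⟨a, b, c, f1, f2, f3, H⟩ := dual_cases (v j) (v (j + 1)) (v (j + 2))
  have g1 := f1; have g2 := f2; have g3 := f3
  rw [← e1] at g1
  rw [← e2] at g2
  rw [← e3] at g3
  rw [dmv, g1, g2, g3]
  unfold dmv
  rcases H with ⟨H, rfl, rfl, rfl⟩ | ⟨H, rfl, rfl, rfl⟩ | ⟨H, H', rfl, rfl, rfl⟩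
  · rw [if_pos (by unfold Btw; omega), if_pos (by unfold Btw; omega), swp_swp]
  · rw [if_neg (by unfold Btw; omega), if_pos (by unfold Btw; omega), if_neg (by unfold Btw; omega),
      if_pos (by unfold Btw; omega), swp_swp]
  · rw [if_neg (by unfold Btw; omega), if_neg (by unfold Btw; omega), if_neg (by unfold Btw; omega),
      if_neg (by unfold Btw; omega)]

theorem Cont.dmv {L j : ℕ} {v : ℕ → ℤ} (h : Cont L v) (hj : j + 2 < L) : Cont L (dmv j v) := by
  unfold PromRS.dmv
  split_ifs with h1 h2
  · exact h.swp hj (by change ¬ Adj (v (j + 1)) (v (j + 2)); unfold Btw at h1; unfold Adj; omega)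
  · exact h.swp (by omega) (by unfold Btw at h2; unfold Adj; omega)
  · exact h

theorem sum_dmv (φ : ℤ → ℤ) (v : ℕ → ℤ) {j s : ℕ} (hs : j + 2 < s) :
    ∑ k ∈ Finset.range s, φ (dmv j v k) = ∑ k ∈ Finset.range s, φ (v k) := by
  unfold dmv
  split_ifs
  · exact sum_swp φ v (by omega)
  · exact sum_swp φ v (by omega)
  · rfl

theorem Cont.quad_hol {L j : ℕ} {v : ℕ → ℤ} (h : Cont L v) (hj : j + 3 < L) :
    Quad (hol v j) (v (j + 1)) (v (j + 2)) (v (j + 3)) := by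
  have := (h.slid (m := j) (by omega)).quad hj
  rwa [slid_self, slid_of_gt _ (by omega), slid_of_gt _ (by omega), slid_of_gt _ (by omega)] at this

theorem nxt_dmv_succ {L j : ℕ} {v : ℕ → ℤ} (h : Cont L v) (hj : j + 3 < L) :
    nxt (dmv (j + 1) v) = dmv j (nxt v) ∧ ∀ m, j + 3 ≤ m → hol (dmv (j + 1) v) m = hol v m := by
  obtain ⟨h1, h2, h3, h4⟩ := (h.quad_hol hj).slide
  set w := dmv (j + 1) v with hw
  have hlow : ∀ i ≤ j, hol w i = hol v i := fun i hi =>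
    hol_congr fun k hk => dmv_apply_of_lt v (by omega)
  have w1 : w (j + 1) = _ := dmv_apply_zero (j + 1) v
  have w2 : w (j + 2) = _ := dmv_apply_one (j + 1) v
  have w3 : w (j + 3) = _ := dmv_apply_two (j + 1) v
  simp only [Nat.add_assoc, Nat.reduceAdd] at w1 w2 w3
  have hhigh : ∀ m, j + 3 ≤ m → hol w m = hol v m := by
    intro m hm
    induction m, hm using Nat.le_induction with
    | base =>
      change carry (carry (carry (hol w j) (w (j + 1))) (w (j + 2))) (w (j + 3)) = _
      rw [hlow j le_rfl, w1, w2, w3]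
      exact h4
    | succ m hm ih =>
      rw [hol, hol, ih, hw, dmv_apply_of_gt v (by omega)]
  refine ⟨?_, hhigh⟩
  funext i
  rcases lt_or_ge i j with hlt | hge
  · rw [dmv_apply_of_lt _ hlt, nxt, nxt, hlow i hlt.le, hw, dmv_apply_of_lt v (by omega)]
  rcases lt_or_ge (j + 2) i with hlt | hge'
  · rw [dmv_apply_of_gt _ hlt, nxt, nxt, hhigh i hlt, hw, dmv_apply_of_gt v (by omega)]
  obtain rfl | rfl | rfl : i = j ∨ i = j + 1 ∨ i = j + 2 := by omega
  · rw [dmv_apply_zero]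
    change stay (hol w i) (w (i + 1)) = _
    rw [hlow i le_rfl, w1]
    exact h1
  · rw [dmv_apply_one]
    change stay (carry (hol w j) (w (j + 1))) (w (j + 2)) = _
    rw [hlow j le_rfl, w1, w2]
    exact h2
  · rw [dmv_apply_two]
    change stay (carry (carry (hol w j) (w (j + 1))) (w (j + 2))) (w (j + 3)) = _
    rw [hlow j le_rfl, w1, w2, w3]
    exact h3

/-- Three consecutive vacated contents move by a dual equivalence. -/
theorem hol_dmv_zero {L : ℕ} {v : ℕ → ℤ} (h : Cont L v) (s : ℕ) (hs : s + 2 < L) :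
    hol (dmv 0 v) (s + 2) =
      dual1 (hol v (s + 2)) (hol (nxt v) (s + 1)) (hol (nxt (nxt v)) s) ∧
    hol (nxt (dmv 0 v)) (s + 1) =
      dual2 (hol v (s + 2)) (hol (nxt v) (s + 1)) (hol (nxt (nxt v)) s) ∧
    hol (nxt (nxt (dmv 0 v))) s =
      dual3 (hol v (s + 2)) (hol (nxt v) (s + 1)) (hol (nxt (nxt v)) s) ∧
    ∀ i < s, nxt (nxt (nxt (dmv 0 v))) i = nxt (nxt (nxt v)) i := by
  induction s with
  | zero =>
    have h0 := h.zero (by omega)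
    have h02 := h.ne_succ_succ (j := 0) hs
    have h12 := h.ne_succ (j := 1) hs
    have h1 : v 1 = 1 ∨ v 1 = -1 := by
      obtain ⟨p, hp, H⟩ := h.nbr 1 (by omega) (by omega)
      obtain rfl : p = 0 := by omega
      omega
    have h2 : v 2 = - v 1 ∨ v 2 = 2 * v 1 := by
      obtain ⟨p, hp, H⟩ := h.nbr 2 (by omega) (by omega)
      simp only [Nat.zero_add, Nat.reduceAdd] at *
      obtain rfl | rfl : p = 0 ∨ p = 1 := by omega
      · omega
      · omega
    have e0 := dmv_apply_zero 0 v
    have e1 := dmv_apply_one 0 v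
    have e2 := dmv_apply_two 0 v
    simp only [Nat.zero_add, nxt, hol, Nat.reduceAdd] at *
    rw [e0, e1, e2, h0]
    refine ⟨?_, ?_, ?_, fun i hi => absurd hi (by omega)⟩ <;>
    rcases h1 with h1 | h1 <;> rw [h1] at h2 ⊢ <;> rcases h2 with h2 | h2 <;> rw [h2] <;> decide
  | succ s ih =>
    obtain ⟨i0, i1, i2, i3⟩ := ih (by omega)
    have hw : PromRS.dmv 0 v (s + 3) = v (s + 3) := dmv_apply_of_gt v (by omega)
    have H : Cont L (slid s (slid (s + 1) (slid (s + 2) v))) :=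
      ((h.slid (by omega)).slid (by omega)).slid (by omega)
    have Q := (H.quad (j := s) (by omega)).symm
    rw [slid_self, slid_of_gt _ (show s < s + 1 by omega), slid_self,
      slid_of_gt _ (show s < s + 2 by omega), slid_of_gt _ (show s + 1 < s + 2 by omega), slid_self,
      slid_of_gt _ (show s < s + 3 by omega), slid_of_gt _ (show s + 1 < s + 3 by omega),
      slid_of_gt _ (show s + 2 < s + 3 by omega)] at Q
    have c1 : hol (slid (s + 2) v) (s + 1) = hol (nxt v) (s + 1) :=
      hol_congr fun i hi => slid_of_lt _ (by omega)
    have c2 : hol (slid (s + 1) (slid (s + 2) v)) s = hol (nxt (nxt v)) s :=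
      hol_congr fun i hi => by
        rw [slid_of_lt _ (by omega)]
        exact nxt_congr fun k hk => slid_of_lt _ (by omega)
    rw [c1, c2] at Q
    obtain ⟨q1, q2, q3, q4⟩ := Q.slide
    have key : ∀ u : ℕ → ℤ, hol u (s + 1 + 2) = stay (u (s + 3)) (hol u (s + 2)) ∧
        hol (nxt u) (s + 1 + 1) = stay (carry (u (s + 3)) (hol u (s + 2))) (hol (nxt u) (s + 1)) ∧
        hol (nxt (nxt u)) (s + 1) = stay (carry (carry (u (s + 3)) (hol u (s + 2)))
          (hol (nxt u) (s + 1))) (hol (nxt (nxt u)) s) ∧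
        nxt (nxt (nxt u)) s = carry (carry (carry (u (s + 3)) (hol u (s + 2)))
          (hol (nxt u) (s + 1))) (hol (nxt (nxt u)) s) := by
      intro u
      simp only [stay_comm (u (s + 3)), carry_comm (u (s + 3))]
      refine ⟨rfl, ?_, ?_, ?_⟩
      · rw [stay_comm]; rfl
      · rw [carry_comm _ (hol (nxt u) (s + 1)), stay_comm]; rfl
      · rw [carry_comm _ (hol (nxt u) (s + 1)), carry_comm]; rfl
    obtain ⟨k1, k2, k3, k4⟩ := key v
    obtain ⟨l1, l2, l3, l4⟩ := key (PromRS.dmv 0 v)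
    rw [hw, i0] at l1
    rw [hw, i0, i1] at l2
    rw [hw, i0, i1, i2] at l3 l4
    rw [l1, l2, l3, k1, k2, k3]
    refine ⟨q1, q2, q3, fun i hi => ?_⟩
    rcases Nat.lt_succ_iff_lt_or_eq.mp hi with hlt | rfl
    · exact i3 i hlt
    · rw [l4, k4, q4]

theorem ev_dmv {L j : ℕ} {v : ℕ → ℤ} (h : Cont L v) (hj : j + 2 < L) :
    ∀ k < L, ev (dmv j v) L k = dmv j (ev v L) k := by
  induction j generalizing L v with
  | zero =>
    obtain ⟨M, rfl⟩ : ∃ M, L = M + 3 := ⟨L - 3, by omega⟩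
    obtain ⟨h0, h1, h2, h3⟩ := hol_dmv_zero h M (by omega)
    intro k hk
    rcases k with _ | _ | _ | k
    · rw [dmv_apply_zero]; exact h0
    · rw [dmv_apply_one]; exact h1
    · rw [dmv_apply_two]; exact h2
    · rw [dmv_apply_of_gt _ (by omega)]
      simp only [ev_succ]
      exact ev_congr (by omega) h3
  | succ j ih =>
    obtain ⟨M, rfl⟩ : ∃ M, L = M + 1 := ⟨L - 1, by omega⟩
    obtain ⟨h1, h2⟩ := nxt_dmv_succ h hj
    intro k hk
    rcases k with _ | k
    · rw [dmv_apply_of_lt _ (by omega)]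
      exact h2 M (by omega)
    · rw [ev_succ, h1, ih h.nxt (by omega) k (by omega), dmv_shift]
      exact dmv_congr (L := M) (by omega) (fun i hi => (ev_succ _ _ _).symm) k (by omega)

theorem pair_slide' {t x y : ℤ} (h1 : t ≠ x) (h2 : x ≠ y) (h3 : t ≠ y) :
    stay (carry t x) y < stay t x ↔ y < x := by
  unfold stay carry Adj
  split_ifs <;> omega

theorem ev_lt_ev {L j : ℕ} {v : ℕ → ℤ} (h : Cont L v) (hj : j + 1 < L) :
    ev v L (j + 1) < ev v L j ↔ v j < v (j + 1) := by
  induction j generalizing L v with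
  | zero =>
    obtain ⟨M, rfl⟩ : ∃ M, L = M + 2 := ⟨L - 2, by omega⟩
    rw [ev_succ, ev_zero, ev_zero]
    show hol (nxt v) M < hol v (M + 1) ↔ _
    have key : ∀ s, s + 1 < M + 2 → (hol (nxt v) s < hol v (s + 1) ↔ v 0 < v 1) := by
      intro s hs
      induction s with
      | zero =>
        have h0 := h.zero (by omega)
        obtain ⟨p, hp, H⟩ := h.nbr 1 (by omega) (by omega)
        obtain rfl : p = 0 := by omega
        change stay (v 0) (v 1) < carry (v 0) (v 1) ↔ v 0 < v 1
        rw [h0] at H ⊢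
        unfold stay carry Adj
        split_ifs <;> omega
      | succ s ih =>
        rw [← ih (by omega)]
        have H : Cont (M + 2) (slid s (slid (s + 1) v)) := (h.slid (by omega)).slid (by omega)
        have a1 := H.ne_succ (j := s) (by omega)
        have a2 := H.ne_succ (j := s + 1) (by omega)
        have a3 := H.ne_succ_succ (j := s) (by omega)
        rw [Nat.add_assoc] at a2
        have c1 : hol (slid (s + 1) v) s = hol (nxt v) s :=
          hol_congr fun i hi => slid_of_lt _ (by omega)
        rw [slid_self, c1] at a1 a3
        rw [slid_of_gt _ (show s < s + 1 by omega), slid_self] at a1 a2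
        rw [slid_of_gt _ (show s < s + (1 + 1) by omega),
          slid_of_gt _ (show s + 1 < s + (1 + 1) by omega)] at a2
        rw [slid_of_gt _ (show s < s + 2 by omega),
          slid_of_gt _ (show s + 1 < s + 2 by omega)] at a3
        rw [← pair_slide' (t := v (s + 2)) a2.symm a1.symm a3.symm, stay_comm (v (s + 2)),
          carry_comm (v (s + 2)), stay_comm]
        rfl
    exact key M (by omega)
  | succ j ih =>
    obtain ⟨M, rfl⟩ : ∃ M, L = M + 1 := ⟨L - 1, by omega⟩
    rw [ev_succ, ev_succ, ih h.nxt (by omega)]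
    have H := h.slid (m := j) (by omega)
    have a1 := H.ne_succ (j := j) (by omega)
    have a2 := H.ne_succ (j := j + 1) (by omega)
    have a3 := H.ne_succ_succ (j := j) (by omega)
    rw [slid_self, slid_of_gt _ (by omega)] at a1 a3
    rw [slid_of_gt _ (by omega), slid_of_gt _ (by omega)] at a2
    exact pair_slide a1 a2 a3

/-- The vacated contents, read backwards, form a content vector. -/
theorem Cont.rev_ev {L : ℕ} {v : ℕ → ℤ} (h : Cont L v) : Cont L fun i => ev v L (L - 1 - i) := by
  have key : ∀ k ≤ L, Cont L fun i =>
      if i < L - k then PromRS.nxt^[k] v i else ev v L (L - 1 - i) := by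
    intro k hk
    induction k with
    | zero => exact h.congr fun i hi => by simp [hi]
    | succ k ih =>
      refine ((ih (by omega)).slid (m := L - k - 1) (by omega)).congr fun i hi => ?_
      rcases lt_trichotomy i (L - k - 1) with h1 | h1 | h1
      · rw [slid_of_lt _ h1, if_pos (by omega), Function.iterate_succ_apply']
        exact nxt_congr fun t ht => by rw [if_pos (by omega)]
      · rw [h1, slid_self, if_neg (by omega)]
        rw [show L - 1 - (L - k - 1) = k by omega, ev, show L - 1 - k = L - k - 1 by omega]
        exact hol_congr fun t ht => by rw [if_pos (by omega)]
      · rw [slid_of_gt _ h1, if_neg (by omega), if_neg (by omega)]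
  simpa using key L le_rfl

/-- Content vector of the row superstandard filling with rows of length `C`. -/
def rowCV (C q : ℕ) : ℤ := (q % C : ℕ) - (q / C : ℕ)

theorem rowCV_mul_add {C i k : ℕ} (hk : k < C) : rowCV C (i * C + k) = k - i := by
  have hC : 0 < C := by omega
  rw [rowCV, mul_comm, Nat.mul_add_mod, Nat.mod_eq_of_lt hk, Nat.mul_add_div hC,
    Nat.div_eq_of_lt hk, add_zero]

theorem exists_mul_add {C : ℕ} (hC : 0 < C) (q : ℕ) : ∃ i k, k < C ∧ q = i * C + k :=
  ⟨q / C, q % C, Nat.mod_lt q hC, by rw [mul_comm]; exact (Nat.div_add_mod q C).symm⟩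

theorem cont_rowCV {C : ℕ} (hC : 0 < C) (L : ℕ) : Cont L (rowCV C) where
  zero _ := by simp [rowCV]
  nbr q h0 _ := by
    obtain ⟨i, k, hk, rfl⟩ := exists_mul_add hC q
    rcases Nat.eq_zero_or_pos k with rfl | hk0
    · obtain ⟨i, rfl⟩ : ∃ i', i = i' + 1 := ⟨i - 1, by
        rcases i with _ | i
        · simp at h0
        · omega⟩
      refine ⟨i * C + 0, by rw [Nat.succ_mul]; omega, Or.inl ?_⟩
      rw [rowCV_mul_add hC, rowCV_mul_add hC]; push_cast; ring
    · refine ⟨i * C + (k - 1), by omega, Or.inr ?_⟩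
      rw [rowCV_mul_add hk, rowCV_mul_add (by omega)]; omega
  sep q s hqs _ H := by
    obtain ⟨i, k, hk, rfl⟩ := exists_mul_add hC q
    obtain ⟨i', k', hk', rfl⟩ := exists_mul_add hC s
    rw [rowCV_mul_add hk, rowCV_mul_add hk'] at H
    have hii : i < i' := by
      by_contra hcon
      have h1 : i' * C ≤ i * C := Nat.mul_le_mul_right C (by omega)
      omega
    have h1 : (i + 1) * C ≤ i' * C := Nat.mul_le_mul_right C hii
    rw [Nat.succ_mul] at h1
    refine ⟨⟨i * C + (k + 1), by omega, by omega, ?_⟩, ⟨(i + 1) * C + k, ?_, ?_, ?_⟩⟩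
    · rw [rowCV_mul_add (by omega), rowCV_mul_add hk]; push_cast; ring
    · rw [Nat.succ_mul]; omega
    · rw [Nat.succ_mul]; omega
    · rw [rowCV_mul_add hk, rowCV_mul_add hk]; push_cast; ring

theorem ev_rowCV {R C : ℕ} (hC : 0 < C) (k : ℕ) (hk : k < R * C) :
    ev (rowCV C) (R * C) k = ((C : ℤ) - R) - rowCV C k := by
  set L := R * C with hL
  have hv := cont_rowCV hC L
  set x : ℕ → ℤ := fun i => ev (rowCV C) L (L - 1 - i) with hx
  have hxc : Cont L x := hv.rev_ev
  have hinc : ∀ i k, k + 1 < C → i < R → x (i * C + k) < x (i * C + (k + 1)) := by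
    intro i k hk hi
    have h1 : (i + 1) * C ≤ R * C := Nat.mul_le_mul_right C hi
    obtain ⟨d, rfl⟩ : ∃ d, R = i + 1 + d := ⟨R - (i + 1), by omega⟩
    have e1 : L - 1 - (i * C + k) = d * C + (C - 1 - (k + 1)) + 1 := by
      rw [hL, Nat.add_mul, Nat.succ_mul]; omega
    have e2 : L - 1 - (i * C + (k + 1)) = d * C + (C - 1 - (k + 1)) := by
      rw [hL, Nat.add_mul, Nat.succ_mul]; omega
    simp only [hx, e1, e2]
    rw [ev_lt_ev hv (by omega), rowCV_mul_add (by omega), Nat.add_assoc, rowCV_mul_add (by omega)]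
    push_cast; omega
  have hge : ∀ q < L, rowCV C q ≤ x q := by
    intro q
    induction q using Nat.strong_induction_on with
    | _ q ih =>
      intro hq
      obtain ⟨i, k, hk, rfl⟩ := exists_mul_add hC q
      have hi : i < R := by
        by_contra hcon
        have := Nat.mul_le_mul_right C (show R ≤ i by omega)
        omega
      rw [rowCV_mul_add hk]
      rcases Nat.eq_zero_or_pos k with rfl | hk0
      · rcases Nat.eq_zero_or_pos i with rfl | hi0
        · simp [hxc.zero (by omega)]
        · have hpos : 0 < i * C := Nat.mul_pos hi0 hC
          obtain ⟨p, hp, H⟩ := hxc.nbr (i * C + 0) (by omega) hq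
          have h2 := ih p hp (by omega)
          obtain ⟨i', k', hk', rfl⟩ := exists_mul_add hC p
          rw [rowCV_mul_add hk'] at h2
          have : i' < i := by
            by_contra hcon
            have := Nat.mul_le_mul_right C (show i ≤ i' by omega)
            omega
          push_cast
          omega
      · have h2 := ih (i * C + (k - 1)) (by omega) (by omega)
        have h3 := hinc i (k - 1) (by omega) hi
        rw [rowCV_mul_add (by omega)] at h2
        rw [show k - 1 + 1 = k by omega] at h3
        omega
  have hsum : ∑ q ∈ Finset.range L, x q = ∑ q ∈ Finset.range L, rowCV C q := by
    have h1 := sum_ev (fun a => a) (rowCV C) L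
    rw [← h1]
    exact Finset.sum_range_reflect (fun q => ev (rowCV C) L q) L
  have heq := (Finset.sum_eq_sum_iff_of_le
    (s := Finset.range L) (f := rowCV C) (g := x) fun q hq => hge q (Finset.mem_range.mp hq)).mp
    hsum.symm
  obtain ⟨i, t, ht, rfl⟩ := exists_mul_add hC k
  have hi : i < R := by
    by_contra hcon
    have := Nat.mul_le_mul_right C (show R ≤ i by omega)
    omega
  obtain ⟨d, rfl⟩ : ∃ d, R = i + 1 + d := ⟨R - (i + 1), by omega⟩
  have e1 : L - 1 - (i * C + t) = d * C + (C - 1 - t) := by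
    rw [hL, Nat.add_mul, Nat.succ_mul]; omega
  have h1 := heq (L - 1 - (i * C + t)) (Finset.mem_range.mpr (by omega))
  simp only [hx] at h1
  rw [show L - 1 - (L - 1 - (i * C + t)) = i * C + t by omega, e1,
    rowCV_mul_add (by omega)] at h1
  rw [← h1, rowCV_mul_add ht]
  push_cast
  omega

theorem Cont.exists_nonneg {L : ℕ} {v : ℕ → ℤ} (h : Cont L v) {a : ℤ} (ha : 0 ≤ a) (q : ℕ)
    (hq : q < L) (haq : a ≤ v q) : ∃ p ≤ q, v p = a := by
  induction q using Nat.strong_induction_on with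
  | _ q ih =>
    rcases haq.eq_or_lt with e | hlt
    · exact ⟨q, le_rfl, e.symm⟩
    · have h0 : 0 < q := by
        rcases Nat.eq_zero_or_pos q with rfl | h0
        · rw [h.zero (by omega)] at hlt; omega
        · exact h0
      obtain ⟨p, hp, H⟩ := h.nbr q h0 hq
      obtain ⟨s, hs, e⟩ := ih p hp (by omega) (by omega)
      exact ⟨s, by omega, e⟩

theorem Cont.neg {L : ℕ} {v : ℕ → ℤ} (h : Cont L v) : Cont L fun i => - v i where
  zero hL := by rw [h.zero hL, neg_zero]
  nbr q h0 hq := by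
    obtain ⟨p, hp, H⟩ := h.nbr q h0 hq
    exact ⟨p, hp, by omega⟩
  sep i j hij hj H := by
    obtain ⟨⟨p, h1, h2, h3⟩, ⟨q, h4, h5, h6⟩⟩ := h.sep i j hij hj (by omega)
    exact ⟨⟨q, h4, h5, by omega⟩, ⟨p, h1, h2, by omega⟩⟩

theorem Cont.exists_nonpos {L : ℕ} {v : ℕ → ℤ} (h : Cont L v) {a : ℤ} (ha : a ≤ 0) (q : ℕ)
    (hq : q < L) (haq : v q ≤ a) : ∃ p ≤ q, v p = a := by
  obtain ⟨p, hp, e⟩ := h.neg.exists_nonneg (a := -a) (by omega) q hq (by omega)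
  exact ⟨p, hp, by omega⟩

/-- Number of occurrences of `a` among the first `s` letters. -/
def cnt (v : ℕ → ℤ) (s : ℕ) (a : ℤ) : ℤ := ∑ k ∈ Finset.range s, if v k = a then 1 else 0

theorem cnt_succ (v : ℕ → ℤ) (s : ℕ) (a : ℤ) :
    cnt v (s + 1) a = cnt v s a + if v s = a then 1 else 0 := Finset.sum_range_succ _ _

theorem cnt_nonneg (v : ℕ → ℤ) (s : ℕ) (a : ℤ) : 0 ≤ cnt v s a :=
  Finset.sum_nonneg fun k _ => by split_ifs <;> norm_num

theorem cnt_pos_iff (v : ℕ → ℤ) (s : ℕ) (a : ℤ) : 0 < cnt v s a ↔ ∃ p < s, v p = a := by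
  induction s with
  | zero => simp [cnt]
  | succ s ih =>
    have := cnt_nonneg v s a
    rw [cnt_succ]
    split_ifs with h
    · exact ⟨fun _ => ⟨s, by omega, h⟩, fun _ => by omega⟩
    · rw [add_zero, ih]
      constructor
      · rintro ⟨p, hp, e⟩; exact ⟨p, by omega, e⟩
      · rintro ⟨p, hp, e⟩
        have : p ≠ s := by rintro rfl; exact h e
        exact ⟨p, by omega, e⟩

theorem exists_last {P : ℕ → Prop} {s : ℕ} (h : ∃ p < s, P p) :
    ∃ p < s, P p ∧ ∀ q, p < q → q < s → ¬ P q := by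
  classical
  induction s with
  | zero => obtain ⟨p, hp, -⟩ := h; omega
  | succ s ih =>
    by_cases hs : P s
    · exact ⟨s, by omega, hs, fun q h1 h2 => by omega⟩
    · have : ∃ p < s, P p := by
        obtain ⟨p, hp, e⟩ := h
        have : p ≠ s := by rintro rfl; exact hs e
        exact ⟨p, by omega, e⟩
      obtain ⟨p, hp, e, H⟩ := ih this
      refine ⟨p, by omega, e, fun q h1 h2 => ?_⟩
      rcases Nat.lt_succ_iff_lt_or_eq.mp h2 with h3 | rfl
      · exact H q h1 h3
      · exact hs

/-- The letters `y` and `y + 1` alternate, so that the counts tell which one came last. -/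
theorem Cont.alternate {L : ℕ} {v : ℕ → ℤ} (h : Cont L v) (y : ℤ) (s : ℕ) (hs : s ≤ L) :
    (cnt v s y - cnt v s (y + 1) = (if 0 ≤ y then 0 else -1) ∧
      ∀ p < s, v p = y → ∃ q, p < q ∧ q < s ∧ v q = y + 1) ∨
    (cnt v s y - cnt v s (y + 1) = (if 0 ≤ y then 0 else -1) + 1 ∧
      ∀ p < s, v p = y + 1 → ∃ q, p < q ∧ q < s ∧ v q = y) := by
  induction s with
  | zero =>
    by_cases hy : 0 ≤ y
    · left; simp [cnt, hy]
    · right; simp [cnt, hy]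
  | succ s ih =>
    have hlast : (∃ p < s, v p = y ∨ v p = y + 1) → ∃ p < s, (v p = y ∨ v p = y + 1) ∧
        ∀ q, p < q → q < s → ¬ (v q = y ∨ v q = y + 1) := exists_last
    have hnone : (¬ ∃ p < s, v p = y ∨ v p = y + 1) → cnt v s y = 0 ∧ cnt v s (y + 1) = 0 := by
      intro hn
      constructor
      · by_contra hc
        obtain ⟨p, hp, e⟩ := (cnt_pos_iff v s y).mp (by have := cnt_nonneg v s y; omega)
        exact hn ⟨p, hp, Or.inl e⟩
      · by_contra hc
        obtain ⟨p, hp, e⟩ := (cnt_pos_iff v s (y + 1)).mp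
          (by have := cnt_nonneg v s (y + 1); omega)
        exact hn ⟨p, hp, Or.inr e⟩
    rw [cnt_succ, cnt_succ]
    rcases ih (by omega) with ⟨hD, H⟩ | ⟨hD, H⟩
    · by_cases h1 : v s = y
      · right
        rw [if_pos h1, if_neg (by omega)]
        exact ⟨by omega, fun p hp e => ⟨s, by
          have : p ≠ s := by rintro rfl; omega
          omega, by omega, h1⟩⟩
      by_cases h2 : v s = y + 1
      · exfalso
        by_cases hex : ∃ p < s, v p = y ∨ v p = y + 1
        · obtain ⟨p, hp, e, hmax⟩ := hlast hex
          rcases e with e | e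
          · obtain ⟨q, a1, a2, a3⟩ := H p hp e
            exact hmax q a1 a2 (Or.inr a3)
          · obtain ⟨-, q, a1, a2, a3⟩ := h.sep p s hp hs (by omega)
            exact hmax q a1 a2 (Or.inl (by omega))
        · obtain ⟨c1, c2⟩ := hnone hex
          have hy : 0 ≤ y := by
            by_contra hy
            rw [if_neg hy] at hD
            omega
          obtain ⟨p, hp, e⟩ := h.exists_nonneg hy s (by omega) (by omega)
          have : p ≠ s := by rintro rfl; omega
          exact hex ⟨p, by omega, Or.inl e⟩
      · left
        rw [if_neg h1, if_neg h2]
        refine ⟨by omega, fun p hp e => ?_⟩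
        have : p ≠ s := by rintro rfl; omega
        obtain ⟨q, a1, a2, a3⟩ := H p (by omega) e
        exact ⟨q, a1, by omega, a3⟩
    · by_cases h1 : v s = y + 1
      · left
        rw [if_neg (show ¬ v s = y by omega), if_pos h1]
        exact ⟨by omega, fun p hp e => ⟨s, by
          have : p ≠ s := by rintro rfl; omega
          omega, by omega, h1⟩⟩
      by_cases h2 : v s = y
      · exfalso
        by_cases hex : ∃ p < s, v p = y ∨ v p = y + 1
        · obtain ⟨p, hp, e, hmax⟩ := hlast hex
          rcases e with e | e
          · obtain ⟨⟨q, a1, a2, a3⟩, -⟩ := h.sep p s hp hs (by omega)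
            exact hmax q a1 a2 (Or.inr (by omega))
          · obtain ⟨q, a1, a2, a3⟩ := H p hp e
            exact hmax q a1 a2 (Or.inl a3)
        · obtain ⟨c1, c2⟩ := hnone hex
          have hy : ¬ 0 ≤ y := by
            intro hy
            rw [if_pos hy] at hD
            omega
          obtain ⟨p, hp, e⟩ := h.exists_nonpos (a := y + 1) (by omega) s (by omega) (by omega)
          have : p ≠ s := by rintro rfl; omega
          exact hex ⟨p, by omega, Or.inr e⟩
      · right
        rw [if_neg h1, if_neg h2]
        refine ⟨by omega, fun p hp e => ?_⟩
        have : p ≠ s := by rintro rfl; omega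
        obtain ⟨q, a1, a2, a3⟩ := H p (by omega) e
        exact ⟨q, a1, by omega, a3⟩

/-- If `v'` ends with `y` and `v` has the same letters, then in `v` no neighbor of `y`
follows the last `y`. -/
theorem Cont.last_of_cnt {L m : ℕ} {v v' : ℕ → ℤ} (h : Cont L v) (h' : Cont L v') (hm : m < L)
    (hc : ∀ a, cnt v (m + 1) a = cnt v' (m + 1) a) (p : ℕ) (hp : p ≤ m)
    (hA : Adj (v p) (v' m)) : ∃ q, p < q ∧ q ≤ m ∧ v q = v' m := by
  rcases hA with e | e
  · have a1 := h.alternate (v' m) (m + 1) hm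
    have a2 := h'.alternate (v' m) (m + 1) hm
    rw [hc, hc] at a1
    rcases a2 with ⟨-, H⟩ | ⟨b2, -⟩
    · obtain ⟨q, c1, c2, -⟩ := H m (by omega) rfl
      omega
    · rcases a1 with ⟨b1, -⟩ | ⟨-, H⟩
      · omega
      · obtain ⟨q, c1, c2, c3⟩ := H p (by omega) e
        exact ⟨q, c1, by omega, c3⟩
  · have a1 := h.alternate (v p) (m + 1) hm
    have a2 := h'.alternate (v p) (m + 1) hm
    rw [← e] at a1 a2
    rw [hc, hc] at a1
    rcases a2 with ⟨b2, -⟩ | ⟨-, H⟩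
    · rcases a1 with ⟨-, H⟩ | ⟨b1, -⟩
      · obtain ⟨q, c1, c2, c3⟩ := H p (by omega) rfl
        exact ⟨q, c1, by omega, c3⟩
      · omega
    · obtain ⟨q, c1, c2, -⟩ := H m (by omega) rfl
      omega

theorem Cont.rotate {L : ℕ} {v : ℕ → ℤ} (h : Cont L v) (p d : ℕ) (hd : p + d < L)
    (hA : ∀ i, p < i → i ≤ p + d → ¬ Adj (v i) (v p)) :
    ∃ w, Cont L w ∧ w (p + d) = v p ∧ (∀ i, p + d < i → w i = v i) ∧
      (∀ i < p, w i = v i) ∧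
      (∀ i, p ≤ i → i < p + d → w i = v (i + 1)) ∧ ∀ s a, p + d < s → cnt w s a = cnt v s a := by
  induction d with
  | zero => exact ⟨v, h, rfl, fun _ _ => rfl, fun _ _ => rfl, fun i _ _ => by omega,
      fun _ _ _ => rfl⟩
  | succ d ih =>
    obtain ⟨w, c1, c2, c3, c6, c4, c5⟩ := ih (by omega) fun i h1 h2 => hA i h1 (by omega)
    refine ⟨PromRS.swp (p + d) w, c1.swp hd ?_, ?_, fun i hi => ?_, fun i hi => ?_,
      fun i hi hi' => ?_, fun s a hs => ?_⟩
    · rw [c2, c3 _ (by omega)]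
      have := hA (p + d + 1) (by omega) (by omega)
      unfold Adj at *
      omega
    · rw [← Nat.add_assoc, swp_right, c2]
    · rw [swp_of_ne _ (by omega) (by omega), c3 i (by omega)]
    · rw [swp_of_ne _ (by omega) (by omega), c6 i (by omega)]
    · rcases Nat.lt_or_ge i (p + d) with hlt | hge
      · rw [swp_of_ne _ (by omega) (by omega), c4 i hi hlt]
      · obtain rfl : i = p + d := by omega
        rw [swp_left, c3 _ (by omega)]
    · rw [cnt, sum_swp (fun b => if b = a then (1 : ℤ) else 0) w (by omega)]
      exact c5 s a (by omega)

/-- The property that the vacated contents are the complements of the contents. -/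
def Compl (L : ℕ) (κ : ℤ) (v : ℕ → ℤ) : Prop := ∀ k < L, ev v L k = κ - v k

theorem Compl.congr {L : ℕ} {κ : ℤ} {v w : ℕ → ℤ} (h : Compl L κ v) (e : ∀ i < L, v i = w i) :
    Compl L κ w := fun k hk => by
  rw [← ev_congr hk e, h k hk, e k hk]

theorem Compl.dmv {L j : ℕ} {κ : ℤ} {v : ℕ → ℤ} (h : Compl L κ v) (hv : Cont L v)
    (hj : j + 2 < L) : Compl L κ (dmv j v) := fun k hk => by
  rw [ev_dmv hv hj k hk, dmv_congr hj h k hk, dmv_sub]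

theorem compl_dmv_iff {L j : ℕ} {κ : ℤ} {v : ℕ → ℤ} (hv : Cont L v) (hj : j + 2 < L) :
    Compl L κ (dmv j v) ↔ Compl L κ v := by
  refine ⟨fun h => ?_, fun h => h.dmv hv hj⟩
  have := h.dmv (hv.dmv hj) hj
  rwa [dmv_dmv hv hj] at this

theorem Cont.compl_iff_aux {L : ℕ} {κ : ℤ} (m : ℕ) (hm : m ≤ L) {v v' : ℕ → ℤ} (h : Cont L v)
    (h' : Cont L v') (hc : ∀ a, cnt v m a = cnt v' m a) (he : ∀ i, m ≤ i → i < L → v i = v' i) :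
    Compl L κ v ↔ Compl L κ v' := by
  induction m generalizing v v' with
  | zero =>
    exact ⟨fun H => H.congr fun i hi => he i (by omega) hi,
      fun H => H.congr fun i hi => (he i (by omega) hi).symm⟩
  | succ m ih =>
    by_cases hxy : v m = v' m
    · refine ih (by omega) h h' (fun a => ?_) fun i hi hi' => ?_
      · have := hc a
        rw [cnt_succ, cnt_succ, hxy] at this
        omega
      · rcases hi.eq_or_lt with rfl | hlt
        · exact hxy
        · exact he i hlt hi'
    have hex : ∃ p < m + 1, v p = v' m := by
      rw [← cnt_pos_iff, hc, cnt_pos_iff]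
      exact ⟨m, by omega, rfl⟩
    obtain ⟨p, hp, hpy, hlast⟩ := exists_last hex
    have hpm : p ≠ m := by rintro rfl; exact hxy hpy
    have hA : ∀ i, p < i → i ≤ m → ¬ Adj (v i) (v' m) := by
      intro i hi him hA
      obtain ⟨q, c1, c2, c3⟩ := h.last_of_cnt h' hm hc i him hA
      exact hlast q (by omega) (by omega) c3
    obtain ⟨u, u1, u2, u3, -, u4, u5⟩ := h.rotate p (m - 1 - p) (by omega) (by
      intro i hi hi'; rw [hpy]; exact hA i hi (by omega))
    rw [show p + (m - 1 - p) = m - 1 by omega] at u2 u3 u4 u5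
    have hxA := hA m (by omega) le_rfl
    have um : u m = v m := u3 m (by omega)
    rw [hpy] at u2
    have hm1 : 1 ≤ m := by omega
    have hz : ∃ t < m - 1, Btw (u t) (v m) (v' m) := by
      have key : ∃ a, Btw a (v m) (v' m) ∧ ∃ q ≤ m, u q = a := by
        unfold Adj at hxA
        rcases lt_or_gt_of_ne hxy with hlt | hgt
        · by_cases hy : 0 < v' m
          · refine ⟨v' m - 1, by unfold Btw; omega, ?_⟩
            obtain ⟨q, hq, e⟩ := u1.exists_nonneg (a := v' m - 1) (by omega) (m - 1) (by omega)
              (by omega)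
            exact ⟨q, by omega, e⟩
          · exact ⟨v m + 1, by unfold Btw; omega,
              u1.exists_nonpos (by omega) m (by omega) (by omega)⟩
        · by_cases hy : v' m < 0
          · refine ⟨v' m + 1, by unfold Btw; omega, ?_⟩
            obtain ⟨q, hq, e⟩ := u1.exists_nonpos (a := v' m + 1) (by omega) (m - 1) (by omega)
              (by omega)
            exact ⟨q, by omega, e⟩
          · exact ⟨v m - 1, by unfold Btw; omega,
              u1.exists_nonneg (by omega) m (by omega) (by omega)⟩
      obtain ⟨a, ha, q, hq, rfl⟩ := key
      have n1 : q ≠ m := by rintro rfl; unfold Btw at ha; omega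
      have n2 : q ≠ m - 1 := by rintro rfl; unfold Btw at ha; omega
      exact ⟨q, by omega, ha⟩
    obtain ⟨t, ht, htb, htlast⟩ := exists_last hz
    have hA2 : ∀ i, t < i → i ≤ t + (m - 2 - t) → ¬ Adj (u i) (u t) := by
      intro i hi hi' hAd
      have hnb := htlast i hi (by omega)
      have hcase : u i = v m ∨ u i = v' m := by
        unfold Btw at htb hnb; unfold Adj at hAd; omega
      unfold Btw at hnb htb htlast
      unfold Adj at hxA
      rcases hcase with e | e
      · obtain ⟨⟨a, a1, a2, a3⟩, ⟨b, b1, b2, b3⟩⟩ := u1.sep i m (by omega) (by omega) (by omega)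
        have na : a ≠ m - 1 := by rintro rfl; omega
        have nb : b ≠ m - 1 := by rintro rfl; omega
        have ha := htlast a (by omega) (by omega)
        have hb := htlast b (by omega) (by omega)
        omega
      · obtain ⟨⟨a, a1, a2, a3⟩, ⟨b, b1, b2, b3⟩⟩ :=
          u1.sep i (m - 1) (by omega) (by omega) (by omega)
        have ha := htlast a (by omega) (by omega)
        have hb := htlast b (by omega) (by omega)
        omega
    obtain ⟨w, w1, w2, w3, -, -, w5⟩ := u1.rotate t (m - 2 - t) (by omega) hA2
    rw [show t + (m - 2 - t) = m - 2 by omega] at w2 w3 w5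
    have wm : w m = v m := by rw [w3 m (by omega), um]
    have wm1 : w (m - 1) = v' m := by rw [w3 _ (by omega), u2]
    obtain ⟨j, rfl⟩ : ∃ j, m = j + 2 := ⟨m - 2, by omega⟩
    have s1 : Compl L κ v ↔ Compl L κ w := by
      refine ih (by omega) h w1 (fun a => ?_) fun i hi hi' => ?_
      · rw [w5 _ _ (by omega), u5 _ _ (by omega)]
      · rw [w3 i (by omega), u3 i (by omega)]
    have hj : j + 2 < L := by omega
    have hlast2 : PromRS.dmv j w (j + 2) = v' (j + 2) := by
      have wm1' : w (j + 1) = v' (j + 2) := wm1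
      have w2' : w j = u t := w2
      rw [dmv_apply_two, dual3, if_pos, wm1']
      rw [w2', wm1', wm]
      unfold Btw at *
      omega
    rw [s1, ← compl_dmv_iff w1 hj]
    refine ih (by omega) (w1.dmv hj) h' (fun a => ?_) fun i hi hi' => ?_
    · have e1 := hc a
      have e2 : cnt (PromRS.dmv j w) (j + 2 + 1) a = cnt v (j + 2 + 1) a := by
        rw [cnt, sum_dmv (fun b => if b = a then (1 : ℤ) else 0) w (by omega)]
        rw [← u5 _ _ (by omega), ← w5 _ _ (by omega), cnt]
      rw [← e2, cnt_succ _ (j + 2), cnt_succ v' (j + 2), hlast2] at e1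
      omega
    · rcases hi.eq_or_lt with rfl | hlt
      · exact hlast2
      · rw [dmv_apply_of_gt _ (by omega), w3 i (by omega), u3 i (by omega), he i (by omega) hi']

/-- Evacuation of a rectangular content vector is complementation. -/
theorem Cont.ev_eq {R C : ℕ} (hC : 0 < C) {v : ℕ → ℤ} (h : Cont (R * C) v)
    (hc : ∀ a, cnt v (R * C) a = cnt (rowCV C) (R * C) a) (k : ℕ) (hk : k < R * C) :
    ev v (R * C) k = ((C : ℤ) - R) - v k :=
  (h.compl_iff_aux (R * C) le_rfl (cont_rowCV hC _) hc fun i h1 h2 => by omega).mpr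
    (fun k hk => ev_rowCV hC k hk) k hk

/-- Standard filling of the `R × C` rectangle with the entries `o + 1, …, o + R * C`. -/
structure IsG (R C o : ℕ) (T : ℕ → ℕ → ℕ) : Prop where
  row : ∀ i j, i < R → j + 1 < C → T i j < T i (j + 1)
  col : ∀ i j, i + 1 < R → j < C → T i j < T (i + 1) j
  bij : Set.BijOn (fun p : ℕ × ℕ => T p.1 p.2) {p : ℕ × ℕ | p.1 < R ∧ p.2 < C}
    (Set.Icc (o + 1) (o + R * C))

theorem IsSYT.isG {R C : ℕ} {T : ℕ → ℕ → ℕ} (h : IsSYT R C T) : IsG R C 0 T :=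
  ⟨h.1, h.2.1, by simpa using h.2.2⟩

section

variable {R C o : ℕ} {T : ℕ → ℕ → ℕ}

theorem IsG.lo (h : IsG R C o T) {i j : ℕ} (hi : i < R) (hj : j < C) : o + 1 ≤ T i j :=
  (h.bij.mapsTo (x := (i, j)) ⟨hi, hj⟩).1

theorem IsG.hi (h : IsG R C o T) {i j : ℕ} (hi : i < R) (hj : j < C) : T i j ≤ o + R * C :=
  (h.bij.mapsTo (x := (i, j)) ⟨hi, hj⟩).2

theorem IsG.inj (h : IsG R C o T) {i j i' j' : ℕ} (hi : i < R) (hj : j < C) (hi' : i' < R)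
    (hj' : j' < C) (e : T i j = T i' j') : i = i' ∧ j = j' := by
  have := h.bij.injOn (show ((i, j) : ℕ × ℕ) ∈ {p : ℕ × ℕ | p.1 < R ∧ p.2 < C} from ⟨hi, hj⟩)
    (show ((i', j') : ℕ × ℕ) ∈ {p : ℕ × ℕ | p.1 < R ∧ p.2 < C} from ⟨hi', hj'⟩) e
  exact Prod.mk.inj this

theorem IsG.surj (h : IsG R C o T) {a : ℕ} (h1 : o + 1 ≤ a) (h2 : a ≤ o + R * C) :
    ∃ i j, i < R ∧ j < C ∧ T i j = a := by
  obtain ⟨p, hp, e⟩ := h.bij.surjOn (show a ∈ Set.Icc (o + 1) (o + R * C) from ⟨h1, h2⟩)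
  exact ⟨p.1, p.2, hp.1, hp.2, e⟩

theorem IsG.le (h : IsG R C o T) {i j i' j' : ℕ} (hi : i ≤ i') (hj : j ≤ j') (hi' : i' < R)
    (hj' : j' < C) : T i j ≤ T i' j' := by
  induction i', hi using Nat.le_induction with
  | base =>
    induction j', hj using Nat.le_induction with
    | base => exact le_rfl
    | succ b hb ih => exact (ih (by omega)).trans (h.row i b hi' hj').le
  | succ a ha ih => exact (ih (by omega)).trans (h.col a j' hi' hj').le

theorem IsG.lt (h : IsG R C o T) {i j i' j' : ℕ} (hi : i ≤ i') (hj : j ≤ j') (hi' : i' < R)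
    (hj' : j' < C) (hne : ¬ (i = i' ∧ j = j')) : T i j < T i' j' :=
  lt_of_le_of_ne (h.le hi hj hi' hj') fun e =>
    hne (h.inj (by omega) (by omega) hi' hj' e)

theorem IsG.corner (h : IsG R C o T) (hR : 0 < R) (hC : 0 < C) : T 0 0 = o + 1 := by
  have hRC := Nat.mul_pos hR hC
  obtain ⟨i, j, hi, hj, e⟩ := h.surj (a := o + 1) le_rfl (by omega)
  have h1 := h.le (Nat.zero_le i) (Nat.zero_le j) hi hj
  have h2 := h.lo hR hC
  omega

theorem IsG.last (h : IsG R C o T) (hR : 0 < R) (hC : 0 < C) :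
    T (R - 1) (C - 1) = o + R * C := by
  have hRC := Nat.mul_pos hR hC
  obtain ⟨i, j, hi, hj, e⟩ := h.surj (a := o + R * C) (by omega) le_rfl
  have h1 := h.le (i' := R - 1) (j' := C - 1) (show i ≤ R - 1 by omega) (show j ≤ C - 1 by omega)
    (by omega) (by omega)
  have h2 := h.hi (i := R - 1) (j := C - 1) (by omega) (by omega)
  omega

theorem IsG.maxEntry_eq (h : IsG R C o T) (hR : 0 < R) (hC : 0 < C) :
    maxEntry R C T = o + R * C := by
  apply le_antisymm
  · refine Finset.sup_le fun p hp => ?_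
    rw [Finset.mem_product, Finset.mem_range, Finset.mem_range] at hp
    exact h.hi hp.1 hp.2
  · rw [← h.last hR hC]
    exact Finset.le_sup (f := fun p : ℕ × ℕ => T p.1 p.2) (b := (R - 1, C - 1))
      (by rw [Finset.mem_product, Finset.mem_range, Finset.mem_range]; omega)

/-- One step of the sliding path inside the rectangle. -/
theorem IsG.nextCell_spec (h : IsG R C o T) {a b : ℕ} (ha : a < R) (hb : b < C)
    (hab : a + b < R + C - 2) :
    (nextCell R C T (a, b) = (a, b + 1) ∧ b + 1 < C ∧ (a + 1 < R → T a (b + 1) < T (a + 1) b)) ∨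
    (nextCell R C T (a, b) = (a + 1, b) ∧ a + 1 < R ∧
      (b + 1 < C → T (a + 1) b < T a (b + 1))) := by
  unfold nextCell ext
  by_cases h1 : a + 1 < R <;> by_cases h2 : b + 1 < C
  · have hne : T a (b + 1) ≠ T (a + 1) b := fun e => by
      have := h.inj ha h2 h1 hb e
      omega
    simp only [ha, hb, h1, h2, and_self, if_true]
    split_ifs with h3
    · exact Or.inl ⟨rfl, trivial, fun _ => by exact_mod_cast h3⟩
    · have h4 : ¬ T a (b + 1) < T (a + 1) b := fun h => h3 (by exact_mod_cast h)
      exact Or.inr ⟨rfl, trivial, fun _ => by omega⟩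
  · simp [ha, hb, h1, h2]
  · simp [ha, hb, h1, h2]
  · omega

theorem slidePath_sum (R C : ℕ) (T : ℕ → ℕ → ℕ) (k : ℕ) :
    (slidePath R C T k).1 + (slidePath R C T k).2 = k := by
  induction k with
  | zero => rfl
  | succ k ih =>
    rw [slidePath, nextCell]
    split_ifs <;> simp only <;> omega

theorem IsG.slidePath_mem (h : IsG R C o T) (hR : 0 < R) (hC : 0 < C) (k : ℕ)
    (hk : k ≤ R + C - 2) : (slidePath R C T k).1 < R ∧ (slidePath R C T k).2 < C := by
  induction k with
  | zero => exact ⟨hR, hC⟩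
  | succ k ih =>
    obtain ⟨h1, h2⟩ := ih (by omega)
    have hs := slidePath_sum R C T k
    rw [slidePath]
    rcases h.nextCell_spec h1 h2 (by omega) with ⟨e, h3, -⟩ | ⟨e, h3, -⟩
    · rw [e]; exact ⟨h1, h3⟩
    · rw [e]; exact ⟨h3, h2⟩

/-- Value on the sliding path. -/
def pv (R C : ℕ) (T : ℕ → ℕ → ℕ) (k : ℕ) : ℕ := T (slidePath R C T k).1 (slidePath R C T k).2

theorem IsG.step (h : IsG R C o T) (hR : 0 < R) (hC : 0 < C) {a b : ℕ} {k : ℕ}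
    (hk : k < R + C - 2) (e : slidePath R C T k = (a, b)) :
    (slidePath R C T (k + 1) = (a, b + 1) ∧ b + 1 < C ∧
      (a + 1 < R → T a (b + 1) < T (a + 1) b)) ∨
    (slidePath R C T (k + 1) = (a + 1, b) ∧ a + 1 < R ∧
      (b + 1 < C → T (a + 1) b < T a (b + 1))) := by
  obtain ⟨h1, h2⟩ := h.slidePath_mem hR hC k hk.le
  have hs := slidePath_sum R C T k
  rw [e] at h1 h2 hs
  rw [slidePath, e]
  exact h.nextCell_spec h1 h2 (by simp only at hs; omega)

theorem IsG.pv_lt_succ (h : IsG R C o T) (hR : 0 < R) (hC : 0 < C) {k : ℕ}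
    (hk : k < R + C - 2) : pv R C T k < pv R C T (k + 1) := by
  obtain ⟨h1, h2⟩ := h.slidePath_mem hR hC k hk.le
  unfold pv
  rcases h.step hR hC hk rfl with ⟨e, h3, -⟩ | ⟨e, h3, -⟩
  · rw [e]; exact h.row _ _ h1 h3
  · rw [e]; exact h.col _ _ h3 h2

theorem IsG.pv_mono (h : IsG R C o T) (hR : 0 < R) (hC : 0 < C) {k l : ℕ} (hkl : k ≤ l)
    (hl : l ≤ R + C - 2) : pv R C T k ≤ pv R C T l := by
  induction l, hkl using Nat.le_induction with
  | base => exact le_rfl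
  | succ l hl' ih => exact (ih (by omega)).trans (h.pv_lt_succ hR hC (by omega)).le

theorem find?_range_eq_some {n k : ℕ} {p : ℕ → Bool} (hk : k < n) (hp : p k = true)
    (hmin : ∀ i < k, p i = false) : (List.range n).find? p = some k := by
  rw [List.find?_range_eq_some]
  exact ⟨hp, List.mem_range.mpr hk, fun i hi => by simp [hmin i hi]⟩

theorem gromotion_corner (R C : ℕ) (T : ℕ → ℕ → ℕ) :
    gromotion R C T (R - 1) (C - 1) = maxEntry R C T + 1 := by simp [gromotion]

theorem gromotion_on {i j : ℕ} (hi : i < R) (hj : j < C) (hc : i + j < R + C - 2)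
    (hp : slidePath R C T (i + j) = (i, j)) : gromotion R C T i j = pv R C T (i + j + 1) := by
  unfold gromotion
  rw [if_neg (by omega), find?_range_eq_some hc (by simpa using hp)]
  · rfl
  · intro k hk
    have := slidePath_sum R C T k
    simp only [decide_eq_false_iff_not]
    intro e
    rw [e] at this
    simp only at this
    omega

theorem gromotion_off {i j : ℕ} (hi : i < R) (hj : j < C) (hc : i + j < R + C - 2)
    (hp : slidePath R C T (i + j) ≠ (i, j)) : gromotion R C T i j = T i j := by
  have : (List.range (R + C - 2)).find? (fun k => decide (slidePath R C T k = (i, j))) = none := by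
    rw [List.find?_eq_none]
    intro k _
    simp only [decide_eq_true_eq]
    intro e
    have := slidePath_sum R C T k
    rw [e] at this
    simp only at this
    subst this
    exact hp e
  unfold gromotion
  rw [if_neg (by omega), this]

theorem IsG.le_gromotion (h : IsG R C o T) {i j : ℕ} (hi : i < R) (hj : j < C) :
    T i j ≤ gromotion R C T i j := by
  have hR : 0 < R := by omega
  have hC : 0 < C := by omega
  by_cases hc : i + j < R + C - 2
  · by_cases hp : slidePath R C T (i + j) = (i, j)
    · rw [gromotion_on hi hj hc hp]
      have := h.pv_lt_succ hR hC hc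
      rw [pv, hp] at this
      exact this.le
    · rw [gromotion_off hi hj hc hp]
  · obtain ⟨rfl, rfl⟩ : i = R - 1 ∧ j = C - 1 := by omega
    rw [gromotion_corner, h.maxEntry_eq hR hC, h.last hR hC]
    omega

theorem IsG.lt_gromotion (h : IsG R C o T) {i j : ℕ} (hi : i < R) (hj : j < C)
    (hp : slidePath R C T (i + j) = (i, j)) : T i j < gromotion R C T i j := by
  have hR : 0 < R := by omega
  have hC : 0 < C := by omega
  by_cases hc : i + j < R + C - 2
  · rw [gromotion_on hi hj hc hp]
    have := h.pv_lt_succ hR hC hc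
    rwa [pv, hp] at this
  · obtain ⟨rfl, rfl⟩ : i = R - 1 ∧ j = C - 1 := by omega
    rw [gromotion_corner, h.maxEntry_eq hR hC, h.last hR hC]
    omega

theorem IsG.gromotion (h : IsG R C o T) (hR : 0 < R) (hC : 0 < C) :
    IsG R C (o + 1) (gromotion R C T) where
  row i j hi hj := by
    by_cases hp : slidePath R C T (i + j) = (i, j)
    · rw [gromotion_on hi (by omega) (by omega) hp, pv]
      rcases h.step hR hC (by omega) hp with ⟨e, h3, -⟩ | ⟨e, h3, h4⟩
      · rw [e]
        exact h.lt_gromotion hi hj e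
      · rw [e]
        exact (h4 hj).trans_le (h.le_gromotion hi hj)
    · rw [gromotion_off hi (by omega) (by omega) hp]
      exact (h.row i j hi hj).trans_le (h.le_gromotion hi hj)
  col i j hi hj := by
    by_cases hp : slidePath R C T (i + j) = (i, j)
    · rw [gromotion_on (by omega) hj (by omega) hp, pv]
      rcases h.step hR hC (by omega) hp with ⟨e, h3, h4⟩ | ⟨e, h3, -⟩
      · rw [e]
        exact (h4 hi).trans_le (h.le_gromotion hi hj)
      · rw [e]
        exact h.lt_gromotion hi hj (by rw [show i + 1 + j = i + j + 1 by omega]; exact e)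
    · rw [gromotion_off (by omega) hj (by omega) hp]
      exact (h.col i j hi hj).trans_le (h.le_gromotion hi hj)
  bij := by
    have hmaps : Set.MapsTo (fun p : ℕ × ℕ => PromRS.gromotion R C T p.1 p.2)
        {p : ℕ × ℕ | p.1 < R ∧ p.2 < C} (Set.Icc (o + 1 + 1) (o + 1 + R * C)) := by
      rintro ⟨i, j⟩ ⟨hi, hj⟩
      simp only at hi hj
      constructor
      · by_cases h0 : i = 0 ∧ j = 0
        · obtain ⟨rfl, rfl⟩ := h0
          have := h.lt_gromotion hi hj rfl
          have := h.corner hR hC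
          simp only
          omega
        · have h1 := h.lt (Nat.zero_le i) (Nat.zero_le j) hi hj (by omega)
          have h2 := h.corner hR hC
          have h3 := h.le_gromotion hi hj
          simp only
          omega
      · simp only
        by_cases hc : i + j < R + C - 2
        · by_cases hp : slidePath R C T (i + j) = (i, j)
          · rw [gromotion_on hi hj hc hp]
            have h1 := h.slidePath_mem hR hC (i + j + 1) (by omega)
            have := h.hi h1.1 h1.2
            unfold pv
            omega
          · rw [gromotion_off hi hj hc hp]
            have := h.hi hi hj
            omega
        · obtain ⟨rfl, rfl⟩ : i = R - 1 ∧ j = C - 1 := by omega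
          rw [gromotion_corner, h.maxEntry_eq hR hC]
          omega
    have hsurj : Set.SurjOn (fun p : ℕ × ℕ => PromRS.gromotion R C T p.1 p.2)
        {p : ℕ × ℕ | p.1 < R ∧ p.2 < C} (Set.Icc (o + 1 + 1) (o + 1 + R * C)) := by
      rintro a ⟨h1, h2⟩
      by_cases hmax : a = o + 1 + R * C
      · refine ⟨(R - 1, C - 1), ⟨by simp only; omega, by simp only; omega⟩, ?_⟩
        simp only
        rw [gromotion_corner, h.maxEntry_eq hR hC]
        omega
      · obtain ⟨i, j, hi, hj, e⟩ := h.surj (a := a) (by omega) (by omega)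
        have hne : ¬ (i = 0 ∧ j = 0) := by
          rintro ⟨rfl, rfl⟩
          rw [h.corner hR hC] at e
          omega
        by_cases hp : slidePath R C T (i + j) = (i, j)
        · obtain ⟨k, hk⟩ : ∃ k, i + j = k + 1 := ⟨i + j - 1, by omega⟩
          have hm := h.slidePath_mem hR hC k (by omega)
          have hs := slidePath_sum R C T k
          refine ⟨slidePath R C T k, hm, ?_⟩
          simp only
          rw [gromotion_on hm.1 hm.2 (by omega) (by rw [hs]), hs, pv, ← hk, hp]
          exact e
        · refine ⟨(i, j), ⟨hi, hj⟩, ?_⟩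
          simp only
          by_cases hc : i + j < R + C - 2
          · rw [gromotion_off hi hj hc hp, e]
          · exfalso
            obtain ⟨rfl, rfl⟩ : i = R - 1 ∧ j = C - 1 := by omega
            have hm := h.slidePath_mem hR hC (R - 1 + (C - 1)) (by omega)
            have hs := slidePath_sum R C T (R - 1 + (C - 1))
            exact hp (Prod.ext (by simp only; omega) (by simp only; omega))
    refine ⟨hmaps, ?_, hsurj⟩
    have e1 : {p : ℕ × ℕ | p.1 < R ∧ p.2 < C} =
        ((Finset.range R ×ˢ Finset.range C : Finset (ℕ × ℕ)) : Set (ℕ × ℕ)) := by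
      ext p; simp
    have e2 : Set.Icc (o + 1 + 1) (o + 1 + R * C) =
        ((Finset.Icc (o + 1 + 1) (o + 1 + R * C) : Finset ℕ) : Set ℕ) := by simp
    rw [e1, e2] at hmaps hsurj
    rw [e1]
    refine Finset.injOn_of_surjOn_of_card_le _ hmaps hsurj ?_
    rw [Finset.card_product, Finset.card_range, Finset.card_range, Nat.card_Icc]
    omega

theorem IsG.gromotion_iter (h : IsG R C o T) (hR : 0 < R) (hC : 0 < C) (k : ℕ) :
    IsG R C (o + k) ((PromRS.gromotion R C)^[k] T) := by
  induction k with
  | zero => exact h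
  | succ k ih =>
    rw [Function.iterate_succ_apply']
    exact ih.gromotion hR hC

end

section

variable {R C o : ℕ} {T : ℕ → ℕ → ℕ}

theorem IsG.slide_cases (h : IsG R C o T) (hR : 0 < R) (hC : 0 < C) {t q i j : ℕ}
    (ht : t < R + C - 2) (h1 : pv R C T t < q) (h2 : q ≤ pv R C T (t + 1)) (hi : i < R)
    (hj : j < C) (e : T i j = q) :
    (q = pv R C T (t + 1) ∧ slidePath R C T (t + 1) = (i, j) ∧
      Adj ((j : ℤ) - i) ((slidePath R C T t).2 - (slidePath R C T t).1)) ∨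
    (q < pv R C T (t + 1) ∧ slidePath R C T (i + j) ≠ (i, j) ∧
      ¬ Adj ((j : ℤ) - i) ((slidePath R C T t).2 - (slidePath R C T t).1)) := by
  obtain ⟨ha, hb⟩ := h.slidePath_mem hR hC t ht.le
  obtain ⟨ha', hb'⟩ := h.slidePath_mem hR hC (t + 1) ht
  rcases h2.eq_or_lt with h2 | h2
  · refine Or.inl ⟨h2, ?_, ?_⟩
    · have := h.inj hi hj ha' hb' (by rw [e, h2, pv])
      exact Prod.ext this.1.symm this.2.symm
    · have := h.inj hi hj ha' hb' (by rw [e, h2, pv])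
      rw [this.1, this.2]
      unfold Adj
      rcases h.step hR hC ht rfl with ⟨e', -⟩ | ⟨e', -⟩ <;> rw [e'] <;> simp only <;> push_cast <;>
        omega
  · refine Or.inr ⟨h2, fun e' => ?_, fun hadj => ?_⟩
    · have h3 : pv R C T (i + j) = q := by rw [pv, e', e]
      rcases le_or_gt (i + j) t with h4 | h4
      · have := h.pv_mono hR hC h4 ht.le
        omega
      · have := h.pv_mono hR hC (show t + 1 ≤ i + j by omega) (by omega)
        omega
    · obtain ⟨a, b, hab⟩ : ∃ a b, slidePath R C T t = (a, b) := ⟨_, _, rfl⟩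
      have hp : pv R C T t = T a b := by rw [pv, hab]
      rw [hab] at hadj ha hb
      simp only at hadj ha hb
      rw [hp] at h1
      have key : (b + 1 < C → q < T a (b + 1)) ∧ (a + 1 < R → q < T (a + 1) b) := by
        rcases h.step hR hC ht hab with ⟨e', h3, h4⟩ | ⟨e', h3, h4⟩ <;> rw [pv, e'] at h2 <;>
          simp only at h2
        · exact ⟨fun _ => h2, fun h5 => h2.trans (h4 h5)⟩
        · exact ⟨fun h5 => h2.trans (h4 h5), fun _ => h2⟩
      rcases hadj with hadj | hadj
      · rcases le_or_gt a i with h5 | h5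
        · have := h.le h5 (show b + 1 ≤ j by omega) hi hj
          have := key.1 (by omega)
          omega
        · have := h.le h5.le (show j ≤ b by omega) ha hb
          omega
      · rcases le_or_gt b j with h5 | h5
        · have := h.le (show a + 1 ≤ i by omega) h5 hi hj
          have := key.2 (by omega)
          omega
        · have := h.le (show i ≤ a by omega) h5.le ha hb
          omega

/-- `v` lists the contents of the cells of the entries `o + 1, …, o + L` of `T`. -/
def IsCV (R C o : ℕ) (T : ℕ → ℕ → ℕ) (L : ℕ) (v : ℕ → ℤ) : Prop :=
  ∀ i j m, i < R → j < C → m < L → T i j = o + 1 + m → v m = (j : ℤ) - i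

theorem IsG.hol_eq (h : IsG R C o T) (hR : 0 < R) (hC : 0 < C) {L : ℕ} {v : ℕ → ℤ}
    (hv : IsCV R C o T L v) {m : ℕ} (hm : m < L) (hL : L ≤ R * C) :
    ∃ t ≤ R + C - 2, pv R C T t ≤ o + 1 + m ∧ (t < R + C - 2 → o + 1 + m < pv R C T (t + 1)) ∧
      hol v m = ((slidePath R C T t).2 : ℤ) - (slidePath R C T t).1 := by
  induction m with
  | zero =>
    have h0 : pv R C T 0 = o + 1 := h.corner hR hC
    refine ⟨0, by omega, by omega, fun h1 => ?_, ?_⟩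
    · have := h.pv_lt_succ hR hC h1
      omega
    · exact hv 0 0 0 hR hC hm h0
  | succ m ih =>
    obtain ⟨t, ht, h1, h2, h3⟩ := ih (by omega)
    have ht' : t < R + C - 2 := by
      refine lt_of_le_of_ne ht fun e => ?_
      have hm := h.slidePath_mem hR hC t ht
      have hs := slidePath_sum R C T t
      have e1 : (slidePath R C T t).1 = R - 1 := by omega
      have e2 : (slidePath R C T t).2 = C - 1 := by omega
      rw [pv, e1, e2, h.last hR hC] at h1
      omega
    obtain ⟨i, j, hi, hj, e⟩ := h.surj (a := o + 1 + (m + 1)) (by omega) (by omega)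
    have hvm := hv i j (m + 1) hi hj hm e
    rcases h.slide_cases hR hC ht' (by omega) (h2 ht') hi hj e with ⟨h4, h5, h6⟩ | ⟨h4, h5, h6⟩
    · refine ⟨t + 1, by omega, by omega, fun h7 => ?_, ?_⟩
      · have := h.pv_lt_succ hR hC h7
        omega
      · rw [hol, carry, if_pos (by rw [hvm, h3]; exact h6), hvm, h5]
    · refine ⟨t, ht, by omega, fun _ => by omega, ?_⟩
      rw [hol, carry, if_neg (by rw [hvm, h3]; exact h6), h3]

theorem IsG.isCV_gromotion (h : IsG R C o T) (hR : 0 < R) (hC : 0 < C) {L : ℕ} {v : ℕ → ℤ}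
    (hv : IsCV R C o T (L + 1) v) (hL : L + 1 ≤ R * C) :
    IsCV R C (o + 1) (PromRS.gromotion R C T) L (nxt v) := by
  intro i' j' m hi' hj' hm e'
  obtain ⟨t, ht, h1, h2, h3⟩ := h.hol_eq hR hC hv (m := m) (by omega) hL
  have ht' : t < R + C - 2 := by
    refine lt_of_le_of_ne ht fun e => ?_
    have hm := h.slidePath_mem hR hC t ht
    have hs := slidePath_sum R C T t
    have e1 : (slidePath R C T t).1 = R - 1 := by omega
    have e2 : (slidePath R C T t).2 = C - 1 := by omega
    rw [pv, e1, e2, h.last hR hC] at h1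
    omega
  obtain ⟨i, j, hi, hj, e⟩ := h.surj (a := o + 1 + (m + 1)) (by omega) (by omega)
  have hvm := hv i j (m + 1) hi hj (by omega) e
  have hG := h.gromotion hR hC
  rcases h.slide_cases hR hC ht' (by omega) (h2 ht') hi hj e with ⟨h4, h5, h6⟩ | ⟨h4, h5, h6⟩
  · have hm := h.slidePath_mem hR hC t ht
    have hs := slidePath_sum R C T t
    have : PromRS.gromotion R C T (slidePath R C T t).1 (slidePath R C T t).2 =
        o + 1 + (m + 1) := by
      rw [gromotion_on hm.1 hm.2 (by omega) (by rw [hs]), hs]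
      exact h4.symm
    have := hG.inj hm.1 hm.2 hi' hj' (by omega)
    rw [nxt, stay, if_pos (by rw [hvm, h3]; exact h6), h3, this.1, this.2]
  · have hc : i + j < R + C - 2 := by
      by_contra hc
      obtain ⟨rfl, rfl⟩ : i = R - 1 ∧ j = C - 1 := by omega
      have hm := h.slidePath_mem hR hC (t + 1) ht'
      have := h.hi hm.1 hm.2
      rw [h.last hR hC] at e
      unfold pv at h4
      omega
    have := gromotion_off hi hj hc h5
    have := hG.inj hi hj hi' hj' (by omega)
    rw [nxt, stay, if_neg (by rw [hvm, h3]; exact h6), hvm, this.1, this.2]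

theorem IsG.isCV_iter (h : IsG R C o T) (hR : 0 < R) (hC : 0 < C) {L : ℕ} {v : ℕ → ℤ} (k : ℕ)
    (hv : IsCV R C o T (L + k) v) (hL : L + k ≤ R * C) :
    IsCV R C (o + k) ((PromRS.gromotion R C)^[k] T) L (nxt^[k] v) := by
  induction k generalizing L with
  | zero => exact hv
  | succ k ih =>
    rw [Function.iterate_succ_apply', Function.iterate_succ_apply']
    exact (h.gromotion_iter hR hC k).isCV_gromotion hR hC
      (ih (by rwa [show L + 1 + k = L + (k + 1) by omega]) (by omega)) (by omega)

theorem IsG.exists_isCV (h : IsG R C o T) : ∃ v, IsCV R C o T (R * C) v := by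
  have : ∀ m, ∃ x : ℤ, m < R * C → ∀ i j, i < R → j < C → T i j = o + 1 + m → x = (j : ℤ) - i := by
    intro m
    by_cases hm : m < R * C
    · obtain ⟨i, j, hi, hj, e⟩ := h.surj (a := o + 1 + m) (by omega) (by omega)
      refine ⟨(j : ℤ) - i, fun _ i' j' hi' hj' e' => ?_⟩
      have := h.inj hi hj hi' hj' (by omega)
      rw [this.1, this.2]
    · exact ⟨0, fun h => absurd h hm⟩
  choose v hv using this
  exact ⟨v, fun i j m hi hj hm e => hv m hm i j hi hj e⟩

theorem IsG.cont (h : IsG R C o T) (hR : 0 < R) (hC : 0 < C) {v : ℕ → ℤ}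
    (hv : IsCV R C o T (R * C) v) : Cont (R * C) v where
  zero hL := by
    have := hv 0 0 0 hR hC hL (h.corner hR hC)
    simpa using this
  nbr q h0 hq := by
    obtain ⟨i, j, hi, hj, e⟩ := h.surj (a := o + 1 + q) (by omega) (by omega)
    have hvq := hv i j q hi hj hq e
    have aux : ∀ i' j', i' < R → j' < C → T i' j' < T i j → ∃ p < q, v p = (j' : ℤ) - i' := by
      intro i' j' hi' hj' hlt
      have := h.lo hi' hj'
      exact ⟨T i' j' - (o + 1), by omega, hv i' j' _ hi' hj' (by omega) (by omega)⟩
    rcases j with _ | j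
    · rcases i with _ | i
      · have := h.corner hR hC
        omega
      · obtain ⟨p, hp, e'⟩ := aux i 0 (by omega) hj (h.col i 0 hi hj)
        exact ⟨p, hp, Or.inl (by rw [e', hvq]; push_cast; ring)⟩
    · obtain ⟨p, hp, e'⟩ := aux i j hi (by omega) (h.row i j hi hj)
      exact ⟨p, hp, Or.inr (by rw [e', hvq]; push_cast; ring)⟩
  sep p q hpq hq hvv := by
    obtain ⟨i, j, hi, hj, e⟩ := h.surj (a := o + 1 + p) (by omega) (by omega)
    obtain ⟨i', j', hi', hj', e'⟩ := h.surj (a := o + 1 + q) (by omega) (by omega)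
    have hvp := hv i j p hi hj (by omega) e
    have hvq := hv i' j' q hi' hj' hq e'
    have hlt : i < i' := by
      by_contra hc
      have := h.le (show i' ≤ i by omega) (show j' ≤ j by omega) hi hj
      omega
    have aux : ∀ a b, a < R → b < C → T i j < T a b → T a b < T i' j' →
        ∃ s, p < s ∧ s < q ∧ v s = (b : ℤ) - a := by
      intro a b ha hb h1 h2
      exact ⟨T a b - (o + 1), by omega, by omega, hv a b _ ha hb (by omega) (by omega)⟩
    constructor
    · obtain ⟨s, h1, h2, h3⟩ := aux i (j + 1) hi (by omega)
        (h.lt le_rfl (Nat.le_succ j) hi (by omega) (by omega))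
        (h.lt hlt.le (by omega) hi' hj' (by omega))
      exact ⟨s, h1, h2, by rw [h3, hvp]; push_cast; ring⟩
    · obtain ⟨s, h1, h2, h3⟩ := aux (i + 1) j (by omega) hj
        (h.lt (Nat.le_succ i) le_rfl (by omega) hj (by omega))
        (h.lt hlt (by omega) hi' hj' (by omega))
      exact ⟨s, h1, h2, by rw [h3, hvp]; push_cast; ring⟩

theorem IsG.cnt_eq (h : IsG R C o T) {v : ℕ → ℤ} (hv : IsCV R C o T (R * C) v) (a : ℤ) :
    cnt v (R * C) a = ∑ p ∈ Finset.range R ×ˢ Finset.range C,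
      if (p.2 : ℤ) - p.1 = a then 1 else 0 := by
  symm
  refine Finset.sum_bij (fun p _ => T p.1 p.2 - (o + 1)) ?_ ?_ ?_ ?_
  · rintro ⟨i, j⟩ hp
    simp only [Finset.mem_product, Finset.mem_range] at hp ⊢
    have := h.lo hp.1 hp.2
    have := h.hi hp.1 hp.2
    omega
  · rintro ⟨i, j⟩ hp ⟨i', j'⟩ hp' e
    simp only [Finset.mem_product, Finset.mem_range] at hp hp' e ⊢
    have := h.lo hp.1 hp.2
    have := h.lo hp'.1 hp'.2
    have := h.inj hp.1 hp.2 hp'.1 hp'.2 (by omega)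
    rw [this.1, this.2]
  · intro m hm
    rw [Finset.mem_range] at hm
    obtain ⟨i, j, hi, hj, e⟩ := h.surj (a := o + 1 + m) (by omega) (by omega)
    exact ⟨(i, j), by simp [hi, hj], by simp only; omega⟩
  · rintro ⟨i, j⟩ hp
    simp only [Finset.mem_product, Finset.mem_range] at hp ⊢
    have := h.lo hp.1 hp.2
    have := h.hi hp.1 hp.2
    rw [hv i j (T i j - (o + 1)) hp.1 hp.2 (by omega) (by omega)]

/-- The row superstandard filling. -/
theorem isG_row (R : ℕ) {C : ℕ} (hC : 0 < C) : IsG R C 0 fun i j => i * C + j + 1 where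
  row i j _ _ := by omega
  col i j _ _ := by
    have : (i + 1) * C = i * C + C := by ring
    omega
  bij := by
    refine ⟨?_, ?_, ?_⟩
    · rintro ⟨i, j⟩ ⟨hi, hj⟩
      have : (i + 1) * C ≤ R * C := Nat.mul_le_mul_right C hi
      have : (i + 1) * C = i * C + C := by ring
      change i < R at hi
      change j < C at hj
      simp only [Set.mem_Icc]
      omega
    · rintro ⟨i, j⟩ ⟨hi, hj⟩ ⟨i', j'⟩ ⟨hi', hj'⟩ e
      change j < C at hj
      change j' < C at hj'
      change i * C + j + 1 = i' * C + j' + 1 at e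
      have e' : i * C + j = i' * C + j' := by omega
      have h1 : (i * C + j) / C = i := by
        rw [mul_comm, Nat.mul_add_div hC, Nat.div_eq_of_lt hj, add_zero]
      have h2 : (i' * C + j') / C = i' := by
        rw [mul_comm, Nat.mul_add_div hC, Nat.div_eq_of_lt hj', add_zero]
      have h3 : i = i' := by rw [← h1, ← h2, e']
      subst h3
      rw [show j = j' by omega]
    · rintro a ⟨h1, h2⟩
      obtain ⟨i, k, hk, e⟩ := exists_mul_add hC (a - 1)
      refine ⟨(i, k), ⟨?_, hk⟩, by simp only; omega⟩
      by_contra hc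
      have : R * C ≤ i * C := Nat.mul_le_mul_right C (by simpa using hc)
      omega

theorem IsG.ev_eq (h : IsG R C o T) (hR : 0 < R) (hC : 0 < C) {v : ℕ → ℤ}
    (hv : IsCV R C o T (R * C) v) {k : ℕ} (hk : k < R * C) :
    ev v (R * C) k = ((C : ℤ) - R) - v k := by
  refine (h.cont hR hC hv).ev_eq hC (fun a => ?_) k hk
  rw [h.cnt_eq hv, (isG_row R hC).cnt_eq (v := rowCV C)]
  intro i j m hi hj hm e
  rw [show m = i * C + j by simp only at e; omega, rowCV_mul_add hj]

end

section

variable {R C o : ℕ} {T : ℕ → ℕ → ℕ}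

theorem IsG.gromotion_le_iff (h : IsG R C o T) (hR : 0 < R) (hC : 0 < C) {t M : ℕ}
    (ht : t ≤ R + C - 2) (h1 : pv R C T t ≤ M) (h2 : t < R + C - 2 → M < pv R C T (t + 1))
    (hM : M ≤ o + R * C) {i j : ℕ} (hi : i < R) (hj : j < C) :
    PromRS.gromotion R C T i j ≤ M ↔ T i j ≤ M ∧ slidePath R C T t ≠ (i, j) := by
  have hst := slidePath_sum R C T t
  by_cases hp : slidePath R C T (i + j) = (i, j)
  · have hT : T i j = pv R C T (i + j) := by rw [pv, hp]
    have hpt : slidePath R C T t = (i, j) ↔ t = i + j := by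
      constructor
      · intro e
        rw [e] at hst
        exact hst.symm
      · rintro rfl
        exact hp
    rw [Ne, hpt, hT]
    by_cases hc : i + j < R + C - 2
    · rw [gromotion_on hi hj hc hp]
      constructor
      · intro h3
        have h4 : i + j < t := by
          by_contra hcon
          have := h.pv_mono hR hC (show t + 1 ≤ i + j + 1 by omega) (by omega)
          have := h2 (by omega)
          omega
        exact ⟨(h.pv_mono hR hC h4.le ht).trans h1, h4.ne'⟩
      · rintro ⟨h3, h4⟩
        have h5 : i + j < t := by
          by_contra hcon
          have := h.pv_mono hR hC (show t + 1 ≤ i + j by omega) (by omega)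
          have := h2 (by omega)
          omega
        exact (h.pv_mono hR hC h5 ht).trans h1
    · obtain ⟨rfl, rfl⟩ : i = R - 1 ∧ j = C - 1 := by omega
      rw [gromotion_corner, h.maxEntry_eq hR hC, ← hT, h.last hR hC]
      constructor
      · intro h3
        omega
      · rintro ⟨h3, h4⟩
        have := h2 (by omega)
        have hm := h.slidePath_mem hR hC (t + 1) (by omega)
        have := h.hi hm.1 hm.2
        unfold pv at *
        omega
  · have hc : i + j < R + C - 2 := by
      by_contra hc
      have hm := h.slidePath_mem hR hC (i + j) (by omega)
      have hs := slidePath_sum R C T (i + j)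
      exact hp (Prod.ext (by simp only; omega) (by simp only; omega))
    rw [gromotion_off hi hj hc hp]
    refine ⟨fun h3 => ⟨h3, fun e => hp ?_⟩, fun h3 => h3.1⟩
    rw [e] at hst
    simp only at hst
    rw [hst, e]

/-- The cells of `gromotion^[k] T` with entries at most `o + R * C` are the rotations of the cells
of `T` with entries larger than `o + k`. -/
theorem IsG.iter_le_iff (h : IsG R C o T) (hR : 0 < R) (hC : 0 < C) {k : ℕ} (hk : k ≤ R * C)
    {i j : ℕ} (hi : i < R) (hj : j < C) :
    (PromRS.gromotion R C)^[k] T i j ≤ o + R * C ↔ o + k < T (R - 1 - i) (C - 1 - j) := by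
  induction k generalizing i j with
  | zero =>
    have := h.lo (i := R - 1 - i) (j := C - 1 - j) (by omega) (by omega)
    exact ⟨fun _ => by omega, fun _ => h.hi hi hj⟩
  | succ k ih =>
    obtain ⟨v, hv⟩ := h.exists_isCV
    have hG := h.gromotion_iter hR hC k
    have hG' := h.gromotion_iter hR hC (k + 1)
    have hcv := h.isCV_iter hR hC (L := R * C - k) k
      (by rwa [show R * C - k + k = R * C by omega]) (by omega)
    obtain ⟨t, ht, h1, h2, h3⟩ := hG.hol_eq hR hC hcv (m := R * C - 1 - k) (by omega) (by omega)
    have h4 := h.ev_eq hR hC hv (k := k) (by omega)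
    rw [ev, h3] at h4
    rw [show o + k + 1 + (R * C - 1 - k) = o + R * C by omega] at h1 h2
    have step := fun {i j : ℕ} (hi : i < R) (hj : j < C) =>
      hG.gromotion_le_iff hR hC ht h1 h2 (by omega) hi hj
    obtain ⟨a, b, ha, hb, hab⟩ := h.surj (a := o + 1 + k) (by omega) (by omega)
    rw [hv a b k ha hb (by omega) hab] at h4
    obtain ⟨⟨x, y⟩, hxy⟩ : ∃ p, slidePath R C ((PromRS.gromotion R C)^[k] T) t = p := ⟨_, rfl⟩
    have hm := hG.slidePath_mem hR hC t ht
    rw [pv] at h1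
    rw [hxy] at h1 h4 hm
    rw [hxy] at step
    rw [Function.iterate_succ_apply'] at hG' ⊢
    simp only at h1 h4 hm
    have hx := (ih (by omega) hm.1 hm.2).1 h1
    have key : R - 1 - x = a ∧ C - 1 - y = b := by
      rcases le_or_gt (R - 1 - x) a with h5 | h5
      · have h6 := h.le h5 (show C - 1 - y ≤ b by omega) ha hb
        exact h.inj (by omega) (by omega) ha hb (by omega)
      · exfalso
        have h6 := (ih (by omega) (i := R - 1 - a) (j := C - 1 - b) (by omega) (by omega)).2 (by
          rw [show R - 1 - (R - 1 - a) = a by omega, show C - 1 - (C - 1 - b) = b by omega]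
          omega)
        have h7 := (step (i := R - 1 - a) (j := C - 1 - b) (by omega) (by omega)).2
          ⟨h6, fun e => by
            have := congrArg Prod.fst e
            simp only at this
            omega⟩
        have h8 : ¬ _ := fun e => ((step hm.1 hm.2).1 e).2 rfl
        have h9 := hG'.le (show x ≤ R - 1 - a by omega) (show y ≤ C - 1 - b by omega) (by omega)
          (by omega)
        exact h8 (h9.trans h7)
    rw [step hi hj, ih (by omega) hi hj]
    have h5 : ((x, y) : ℕ × ℕ) ≠ (i, j) ↔ T (R - 1 - i) (C - 1 - j) ≠ o + 1 + k := by
      refine not_congr ⟨fun e => ?_, fun e => ?_⟩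
      · have e1 := congrArg Prod.fst e
        have e2 := congrArg Prod.snd e
        simp only at e1 e2
        rw [← e1, ← e2, key.1, key.2, hab]
      · have := h.inj (by omega) (by omega) ha hb (e.trans hab.symm)
        exact Prod.ext (by simp only; omega) (by simp only; omega)
    rw [h5]
    omega

theorem IsG.iter_full (h : IsG R C o T) (hR : 0 < R) (hC : 0 < C) {i j : ℕ} (hi : i < R)
    (hj : j < C) : (PromRS.gromotion R C)^[R * C] T i j = T i j + R * C := by
  have key : ∀ k ≤ R * C, (PromRS.gromotion R C)^[R * C] T i j ≤ o + k + R * C ↔ T i j ≤ o + k := by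
    intro k hk
    have h1 := (h.gromotion_iter hR hC k).iter_le_iff hR hC (k := R * C - k) (by omega) hi hj
    rw [← Function.iterate_add_apply, show R * C - k + k = R * C by omega] at h1
    have h2 := h.iter_le_iff hR hC hk (i := R - 1 - i) (j := C - 1 - j) (by omega) (by omega)
    rw [show R - 1 - (R - 1 - i) = i by omega, show C - 1 - (C - 1 - j) = j by omega] at h2
    omega
  have h1 := h.lo hi hj
  have h2 := h.hi hi hj
  have h3 := key (T i j - o) (by omega)
  have h4 := key (T i j - o - 1) (by omega)
  omega

end

/-- Column `k` of `G` arises from column `k` of `S` by shifting the bottom half up by `h k`. -/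
def Shifted (r c o : ℕ) (S : ℕ → ℕ → ℕ) (h : ℕ → ℕ) (G : ℕ → ℕ → ℕ) : Prop :=
  ∀ i k, i < 2 * r → k < c → (i + h k < r → G i k ≤ o + r * c) ∧
    (r ≤ i + h k → i + h k < 2 * r → G i k = S (i + h k) k) ∧
    (2 * r ≤ i + h k → o + 2 * (r * c) < G i k)

/-- The entries of the top half are smaller than the entries of the bottom half. -/
structure IsStacked (r c o : ℕ) (S : ℕ → ℕ → ℕ) : Prop extends IsG (2 * r) c o S where
  top : ∀ i k, i < r → k < c → S i k ≤ o + r * c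
  bot : ∀ i k, r ≤ i → i < 2 * r → k < c → o + r * c < S i k

section

variable {r c o j : ℕ} {S G : ℕ → ℕ → ℕ} {h : ℕ → ℕ}

theorem slidePath_fst_mono (R C : ℕ) (T : ℕ → ℕ → ℕ) :
    Monotone fun k => (slidePath R C T k).1 := by
  refine monotone_nat_of_le_succ fun k => ?_
  rw [slidePath, nextCell]
  split_ifs <;> simp

theorem slideInto_eq {R C : ℕ} {t a k i : ℕ}
    (ht : slidePath R C G t = (a, k)) (hai : a < i) (hi : i < R) (hk : k < C)
    (hs : ∀ s ≤ i - a, slidePath R C G (t + s) = (a + s, k)) : slideInto R C G i = G i k := by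
  have hsum := slidePath_sum R C G t
  rw [ht] at hsum
  simp only at hsum
  have hp : slidePath R C G (i + k) = (i, k) := by
    have := hs (i - a) le_rfl
    rwa [show t + (i - a) = i + k by omega, show a + (i - a) = i by omega] at this
  unfold slideInto
  rw [find?_range_eq_some (k := i + k) (by omega) (by simp [hp])]
  · simp only [hp]
  · intro s hsl
    simp only [decide_eq_false_iff_not]
    rcases le_or_gt s t with h1 | h1
    · have := slidePath_fst_mono R C G h1
      simp only [ht] at this
      omega
    · have := hs (s - t) (by omega)
      rw [show t + (s - t) = s by omega] at this
      rw [this]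
      simp only
      omega

theorem IsStacked.le (hS : IsStacked r c o S) {i k : ℕ} (hi : i < 2 * r) (hk : k < c) :
    S i k ≤ o + 2 * (r * c) := by
  have := hS.hi hi hk
  rwa [mul_assoc] at this

theorem IsStacked.step (hS : IsStacked r c o S) (hr : 0 < r) (hc : 0 < c)
    (hG : IsG (2 * r) c (o + j) G) (hj : j < r * c) (hh : Shifted r c o S h G) :
    ∃ k < c, h k < r ∧ Shifted r c o S (Function.update h k (h k + 1)) (gromotion (2 * r) c G) ∧
      slideInto (2 * r) c G r = S (r + h k) k := by
  have hR : 0 < 2 * r := by omega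
  have hN : 2 * r * c = 2 * (r * c) := mul_assoc _ _ _
  have gt_of : ∀ i k, i < 2 * r → k < c → r ≤ i + h k → o + r * c < G i k := by
    intro i k hi hk h1
    rcases lt_or_ge (i + h k) (2 * r) with h2 | h2
    · rw [(hh i k hi hk).2.1 h1 h2]
      exact hS.bot _ _ h1 h2 hk
    · have := (hh i k hi hk).2.2 h2
      omega
  have le_iff : ∀ i k, i < 2 * r → k < c → (G i k ≤ o + r * c ↔ i + h k < r) := by
    intro i k hi hk
    refine ⟨fun h1 => ?_, (hh i k hi hk).1⟩
    by_contra h2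
    have := gt_of i k hi hk (by omega)
    omega
  obtain ⟨t, ht, h1, h2⟩ : ∃ t ≤ 2 * r + c - 2, pv (2 * r) c G t ≤ o + r * c ∧
      (t < 2 * r + c - 2 → o + r * c < pv (2 * r) c G (t + 1)) := by
    obtain ⟨t, h1, h2, h3⟩ := exists_last (P := fun t => pv (2 * r) c G t ≤ o + r * c)
      (s := 2 * r + c - 1) ⟨0, by omega, by
        have := hG.corner hR hc
        simp only [pv, slidePath]
        omega⟩
    exact ⟨t, by omega, h2, fun h4 => not_le.1 (h3 (t + 1) (by omega) (by omega))⟩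
  obtain ⟨a, k, hak⟩ : ∃ a k, slidePath (2 * r) c G t = (a, k) := ⟨_, _, rfl⟩
  have hm := hG.slidePath_mem hR hc t ht
  have hsum := slidePath_sum (2 * r) c G t
  have h1' := h1
  rw [pv, hak] at h1'
  rw [hak] at hm hsum
  simp only at hm hsum h1'
  obtain ⟨ha, hk⟩ := hm
  rw [le_iff a k ha hk] at h1'
  have htlt : t < 2 * r + c - 2 := by omega
  have h2' := h2 htlt
  have hnext : a + 1 + h k = r ∧ (k + 1 < c → r ≤ a + h (k + 1)) := by
    have e1 : o + r * c < G (a + 1) k ∧ (k + 1 < c → o + r * c < G a (k + 1)) := by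
      rcases hG.step hR hc htlt hak with ⟨e, h3, h4⟩ | ⟨e, h3, h4⟩ <;> rw [pv, e] at h2' <;>
        simp only at h2'
      · exact ⟨h2'.trans (h4 (by omega)), fun _ => h2'⟩
      · exact ⟨h2', fun h5 => h2'.trans (h4 h5)⟩
    constructor
    · by_contra h3
      have := (le_iff (a + 1) k (by omega) hk).2 (by omega)
      omega
    · intro h4
      by_contra h3
      have := (le_iff a (k + 1) ha h4).2 (by omega)
      have := e1.2 h4
      omega
  obtain ⟨hk1, hk2⟩ := hnext
  have hpath : ∀ s ≤ r, slidePath (2 * r) c G (t + s) = (a + s, k) := by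
    intro s hs
    induction s with
    | zero => exact hak
    | succ s ih =>
      rcases hG.step hR hc (show t + s < 2 * r + c - 2 by omega) (ih (by omega)) with
        ⟨e, h3, h4⟩ | ⟨e, h3, h4⟩
      · exfalso
        have h5 := h4 (by omega)
        rw [(hh (a + s + 1) k (by omega) hk).2.1 (by omega) (by omega)] at h5
        have h6 := hk2 h3
        rcases lt_or_ge (a + s + h (k + 1)) (2 * r) with h7 | h7
        · rw [(hh (a + s) (k + 1) (by omega) h3).2.1 (by omega) h7] at h5
          have := hS.toIsG.le (show a + s + 1 + h k ≤ a + s + h (k + 1) by omega)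
            (Nat.le_succ k) h7 h3
          exact absurd h5 (not_lt.2 this)
        · have := (hh (a + s) (k + 1) (by omega) h3).2.2 h7
          have := hS.le (show a + s + 1 + h k < 2 * r by omega) hk
          omega
      · exact e
  have hend : t + r < 2 * r + c - 2 → o + 2 * (r * c) < pv (2 * r) c G (t + r + 1) := by
    intro h3
    rcases hG.step hR hc h3 (hpath r le_rfl) with ⟨e, h4, -⟩ | ⟨e, h4, -⟩ <;> rw [pv, e] <;>
      simp only
    · exact (hh _ _ (by omega) h4).2.2 (by have := hk2 h4; omega)
    · exact (hh _ _ h4 hk).2.2 (by omega)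
  have hle := fun {i j : ℕ} (hi : i < 2 * r) (hj : j < c) =>
    hG.gromotion_le_iff hR hc ht h1 h2 (by omega) hi hj
  rw [hak] at hle
  refine ⟨k, hk, by omega, ?_, ?_⟩
  · intro i k' hi hk'
    by_cases hkk : k' = k
    · subst hkk
      rw [Function.update_self]
      refine ⟨fun h3 => ?_, fun h3 h4 => ?_, fun h3 => ?_⟩
      · refine (hle hi hk').2 ⟨(le_iff _ _ hi hk').2 (by omega), fun e => ?_⟩
        have := congrArg Prod.fst e
        simp only at this
        omega
      · have e1 := hpath (i - a) (by omega)
        have e2 := hpath (i - a + 1) (by omega)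
        rw [show t + (i - a) = i + k' by omega, show a + (i - a) = i by omega] at e1
        rw [show t + (i - a + 1) = i + k' + 1 by omega, show a + (i - a + 1) = i + 1 by omega] at e2
        rw [gromotion_on hi hk' (by omega) e1, pv, e2]
        simp only
        rw [(hh (i + 1) k' (by omega) hk').2.1 (by omega) (by omega)]
        congr 1
        omega
      · by_cases h4 : i = a + r
        · have e1 := hpath r le_rfl
          rw [← h4, show t + r = i + k' by omega] at e1
          by_cases h5 : i + k' < 2 * r + c - 2
          · rw [gromotion_on hi hk' h5 e1]
            have := hend (by omega)
            rwa [show t + r = i + k' by omega] at this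
          · obtain ⟨rfl, rfl⟩ : i = 2 * r - 1 ∧ k' = c - 1 := by omega
            rw [gromotion_corner, hG.maxEntry_eq hR hc]
            omega
        · exact ((hh i k' hi hk').2.2 (by omega)).trans_le (hG.le_gromotion hi hk')
    · rw [Function.update_of_ne hkk]
      refine ⟨fun h3 => ?_, fun h3 h4 => ?_, fun h3 => ?_⟩
      · refine (hle hi hk').2 ⟨(le_iff _ _ hi hk').2 h3, fun e => ?_⟩
        have := congrArg Prod.snd e
        simp only at this
        omega
      · have hoff : slidePath (2 * r) c G (i + k') ≠ (i, k') := by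
          intro e
          have e' : pv (2 * r) c G (i + k') = G i k' := by rw [pv, e]
          rcases le_or_gt (i + k') t with h5 | h5
          · have := hG.pv_mono hR hc h5 ht
            have := gt_of i k' hi hk' h3
            omega
          · rcases le_or_gt (i + k') (t + r) with h6 | h6
            · have e1 := hpath (i + k' - t) (by omega)
              rw [show t + (i + k' - t) = i + k' by omega, e] at e1
              exact hkk (congrArg Prod.snd e1)
            · have := hG.pv_mono hR hc (show t + r + 1 ≤ i + k' by omega) (by omega)
              have := hend (by omega)
              have := (hh i k' hi hk').2.1 h3 h4
              have := hS.le h4 hk'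
              omega
        have hc' : i + k' < 2 * r + c - 2 := by
          by_contra hcon
          have hm := hG.slidePath_mem hR hc (i + k') (by omega)
          have hs := slidePath_sum (2 * r) c G (i + k')
          exact hoff (Prod.ext (by simp only; omega) (by simp only; omega))
        rw [gromotion_off hi hk' hc' hoff, (hh i k' hi hk').2.1 h3 h4]
      · exact ((hh i k' hi hk').2.2 h3).trans_le (hG.le_gromotion hi hk')
  · rw [slideInto_eq hak (by omega) (by omega) hk fun s hs => hpath s (by omega)]
    exact (hh r k (by omega) hk).2.1 (by omega) (by omega)

theorem IsStacked.exists_shifted (hS : IsStacked r c o S) (hr : 0 < r) (hc : 0 < c)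
    (hj : j ≤ r * c) : ∃ h : ℕ → ℕ, (∀ k < c, h k ≤ r) ∧
      Shifted r c o S h ((gromotion (2 * r) c)^[j] S) := by
  induction j with
  | zero =>
    refine ⟨fun _ => 0, fun _ _ => Nat.zero_le r, fun i k hi hk => ⟨fun h1 => hS.top i k h1 hk,
      fun _ _ => rfl, fun h1 => ?_⟩⟩
    simp only at h1
    omega
  | succ j ih =>
    obtain ⟨h, h1, h2⟩ := ih (by omega)
    have hG := hS.gromotion_iter (by omega) hc j
    obtain ⟨k, hk, h3, h4, -⟩ := hS.step hr hc hG (by omega) h2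
    rw [Function.iterate_succ_apply']
    refine ⟨_, fun k' hk' => ?_, h4⟩
    by_cases e : k' = k
    · subst e
      rw [Function.update_self]
      omega
    · rw [Function.update_of_ne e]
      exact h1 k' hk'

theorem IsStacked.slideInto_iter (hS : IsStacked r c o S) (hr : 0 < r) (hc : 0 < c)
    (hj : j < r * c) : ∃ i < r, ∃ k < c, S i (c - 1 - k) = o + j + 1 ∧
      slideInto (2 * r) c ((gromotion (2 * r) c)^[j] S) r = S (r + i) k := by
  have hR : 0 < 2 * r := by omega
  have hN : 2 * r * c = 2 * (r * c) := mul_assoc _ _ _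
  obtain ⟨h, h1, h2⟩ := hS.exists_shifted hr hc hj.le
  have hG := hS.gromotion_iter (by omega) hc j
  obtain ⟨k, hk, h3, h4, h5⟩ := hS.step hr hc hG hj h2
  refine ⟨h k, h3, k, hk, ?_, h5⟩
  have e1 := hS.iter_le_iff hR hc (k := j) (by omega) (i := 2 * r - 1 - h k) (by omega) hk
  have e2 := hS.iter_le_iff hR hc (k := j + 1) (by omega) (i := 2 * r - 1 - h k) (by omega) hk
  rw [Function.iterate_succ_apply'] at e2
  rw [show 2 * r - 1 - (2 * r - 1 - h k) = h k by omega] at e1 e2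
  have e3 := (h4 (2 * r - 1 - h k) k (by omega) hk).2.2 (by rw [Function.update_self]; omega)
  have e4 := (h2 (2 * r - 1 - h k) k (by omega) hk).2.1 (by omega) (by omega)
  have e5 := hS.le (show 2 * r - 1 - h k + h k < 2 * r by omega) hk
  omega

theorem IsStacked.iter_half (hS : IsStacked r c o S) (hr : 0 < r) (hc : 0 < c) :
    IsStacked r c (o + r * c) ((gromotion (2 * r) c)^[r * c] S) ∧
      ∀ i k, i < r → k < c → (gromotion (2 * r) c)^[r * c] S i k = S (r + i) k := by
  obtain ⟨h, h1, h2⟩ := hS.exists_shifted hr hc le_rfl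
  have hG := hS.gromotion_iter (by omega) hc (r * c)
  have h3 : ∀ k < c, h k = r := by
    intro k hk
    have := h1 k hk
    by_contra hcon
    have e1 := (h2 0 k (by omega) hk).1 (by omega)
    have := hG.lo (show 0 < 2 * r by omega) hk
    omega
  have h4 : ∀ i k, i < r → k < c → (gromotion (2 * r) c)^[r * c] S i k = S (r + i) k := by
    intro i k hi hk
    have := (h2 i k (by omega) hk).2.1 (by rw [h3 k hk]; omega) (by rw [h3 k hk]; omega)
    rw [this, h3 k hk, add_comm]
  refine ⟨⟨hG, fun i k hi hk => ?_, fun i k hi hi' hk => ?_⟩, h4⟩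
  · rw [h4 i k hi hk]
    have := hS.le (show r + i < 2 * r by omega) hk
    omega
  · have := (h2 i k hi' hk).2.2 (by rw [h3 k hk]; omega)
    omega

theorem IsStacked.iter_half_bot (hS : IsStacked r c o S) (hr : 0 < r) (hc : 0 < c) {i k : ℕ}
    (hi : i < r) (hk : k < c) :
    (gromotion (2 * r) c)^[r * c] S (r + i) k = S i k + 2 * (r * c) := by
  obtain ⟨h1, h2⟩ := hS.iter_half hr hc
  obtain ⟨h3, h4⟩ := h1.iter_half hr hc
  rw [← h4 i k hi hk, ← Function.iterate_add_apply, ← two_mul, ← mul_assoc,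
    hS.iter_full (by omega) hc (by omega) hk]

end

theorem isStacked_stack {r c : ℕ} {P Q : ℕ → ℕ → ℕ} (hP : IsSYT r c P) (hQ : IsSYT r c Q) :
    IsStacked r c 0 (stack r c P Q) := by
  have hP' := hP.isG
  have hQ' := hQ.isG
  have top : ∀ i k, i < r → stack r c P Q i k = P i k := fun i k hi => by simp [stack, hi]
  have bot : ∀ i k, r ≤ i → stack r c P Q i k = Q (i - r) k + r * c := fun i k hi => by
    simp [stack, hi]
  refine ⟨⟨fun i k hi hk => ?_, fun i k hi hk => ?_, ?_, ?_, ?_⟩, fun i k hi hk => ?_,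
    fun i k hi hi' hk => ?_⟩
  · rcases lt_or_ge i r with h | h
    · rw [top _ _ h, top _ _ h]
      exact hP.1 i k h hk
    · rw [bot _ _ h, bot _ _ h]
      have := hQ.1 (i - r) k (by omega) hk
      omega
  · rcases lt_or_ge i r with h | h
    · rcases lt_or_ge (i + 1) r with h1 | h1
      · rw [top _ _ h, top _ _ h1]
        exact hP.2.1 i k h1 hk
      · rw [top _ _ h, bot _ _ h1]
        have := hP'.hi h hk
        have := hQ'.lo (show i + 1 - r < r by omega) hk
        omega
    · rw [bot _ _ h, bot _ _ (by omega), show i + 1 - r = i - r + 1 by omega]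
      have := hQ.2.1 (i - r) k (by omega) hk
      omega
  · rintro ⟨i, k⟩ ⟨hi, hk⟩
    change i < 2 * r at hi
    change k < c at hk
    have : 2 * r * c = r * c + r * c := by ring
    simp only [Set.mem_Icc]
    rcases lt_or_ge i r with h | h
    · rw [top _ _ h]
      have := hP'.hi h hk
      have := hP'.lo h hk
      omega
    · rw [bot _ _ h]
      have := hQ'.hi (show i - r < r by omega) hk
      have := hQ'.lo (show i - r < r by omega) hk
      omega
  · rintro ⟨i, k⟩ ⟨hi, hk⟩ ⟨i', k'⟩ ⟨hi', hk'⟩ e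
    change i < 2 * r at hi
    change k < c at hk
    change i' < 2 * r at hi'
    change k' < c at hk'
    simp only at e
    rcases lt_or_ge i r with h | h <;> rcases lt_or_ge i' r with h' | h'
    · rw [top _ _ h, top _ _ h'] at e
      have := hP'.inj h hk h' hk' e
      rw [this.1, this.2]
    · rw [top _ _ h, bot _ _ h'] at e
      have := hP'.hi h hk
      have := hQ'.lo (show i' - r < r by omega) hk'
      omega
    · rw [bot _ _ h, top _ _ h'] at e
      have := hP'.hi h' hk'
      have := hQ'.lo (show i - r < r by omega) hk
      omega
    · rw [bot _ _ h, bot _ _ h'] at e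
      have := hQ'.inj (show i - r < r by omega) hk (show i' - r < r by omega) hk' (by omega)
      exact Prod.ext (by simp only; omega) this.2
  · rintro a ⟨h1, h2⟩
    have : 2 * r * c = r * c + r * c := by ring
    rcases le_or_gt a (r * c) with h | h
    · obtain ⟨i, k, hi, hk, e⟩ := hP'.surj (a := a) h1 (by omega)
      exact ⟨(i, k), ⟨by simp only; omega, hk⟩, by simp only; rw [top _ _ hi, e]⟩
    · obtain ⟨i, k, hi, hk, e⟩ := hQ'.surj (a := a - r * c) (by omega) (by omega)
      refine ⟨(r + i, k), ⟨by simp only; omega, hk⟩, ?_⟩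
      simp only
      rw [bot _ _ (by omega), show r + i - r = i by omega]
      omega
  · rw [top _ _ hi]
    exact hP'.hi hi hk
  · rw [bot _ _ hi]
    have := hQ'.lo (show i - r < r by omega) hk
    omega

theorem promPerm_stack {r c : ℕ} {P Q : ℕ → ℕ → ℕ} (hP : IsSYT r c P) (hQ : IsSYT r c Q)
    {i k : ℕ} (hi : i < r) (hk : k < c) :
    promPerm (2 * r) c (stack r c P Q) r (P i (c - 1 - k)) = r * c + Q i k ∧
      promPerm (2 * r) c (stack r c P Q) r (r * c + Q i (c - 1 - k)) = P i k := by
  have hr : 0 < r := by omega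
  have hc : 0 < c := by omega
  have hP' := hP.isG
  have hQ' := hQ.isG
  have hS := isStacked_stack hP hQ
  have hN : 2 * r * c = 2 * (r * c) := mul_assoc _ _ _
  have top : ∀ i k, i < r → stack r c P Q i k = P i k := fun i k hi => by simp [stack, hi]
  have bot : ∀ i k, stack r c P Q (r + i) k = Q i k + r * c := fun i k => by
    simp [stack]
  have hk' : c - 1 - k < c := by omega
  constructor
  · have h1 := hP'.lo hi hk'
    have h2 := hP'.hi hi hk'
    obtain ⟨i', hi', k', hk'', e1, e2⟩ := hS.slideInto_iter hr hc
      (j := P i (c - 1 - k) - 1) (by omega)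
    rw [top _ _ hi'] at e1
    obtain ⟨rfl, e3⟩ := hP'.inj hi' (by omega) hi hk'
      (show P i' (c - 1 - k') = P i (c - 1 - k) by omega)
    obtain rfl : k' = k := by omega
    have h3 := hQ'.lo hi hk
    have h4 := hQ'.hi hi hk
    rw [promPerm, e2, bot, Nat.mod_eq_of_lt (by omega)]
    omega
  · obtain ⟨hS', htop⟩ := hS.iter_half hr hc
    have h1 := hQ'.lo hi hk'
    have h2 := hQ'.hi hi hk'
    obtain ⟨i', hi', k', hk'', e1, e2⟩ := hS'.slideInto_iter hr hc
      (j := Q i (c - 1 - k) - 1) (by omega)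
    rw [htop _ _ hi' (by omega), bot] at e1
    obtain ⟨rfl, e3⟩ := hQ'.inj hi' (by omega) hi hk'
      (show Q i' (c - 1 - k') = Q i (c - 1 - k) by omega)
    obtain rfl : k' = k := by omega
    have h3 := hP'.lo hi hk
    have h4 := hP'.hi hi hk
    rw [← Function.iterate_add_apply,
      show Q i' (c - 1 - k') - 1 + r * c = r * c + Q i' (c - 1 - k') - 1 by omega,
      hS.iter_half_bot hr hc hi hk, top _ _ hi] at e2
    rw [promPerm, e2, hN, show P i' k' + 2 * (r * c) - 1 = P i' k' - 1 + 2 * (r * c) by omega,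
      Nat.add_mod_right, Nat.mod_eq_of_lt (by omega)]
    omega

/-- There is a chain of `k + 1` positive integers ending at `a` with consecutive members related
by both `<` and `ρ`. -/
def EndsChain (ρ : ℕ → ℕ → Prop) : ℕ → ℕ → Prop
  | 0, a => 1 ≤ a
  | k + 1, a => ∃ a' < a, ρ a' a ∧ EndsChain ρ k a'

theorem EndsChain.exists_seq {ρ : ℕ → ℕ → Prop} {k a : ℕ} (h : EndsChain ρ k a) :
    ∃ s : ℕ → ℕ, s k = a ∧ (∀ i ≤ k, 1 ≤ s i ∧ s i ≤ a) ∧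
      ∀ i < k, s i < s (i + 1) ∧ ρ (s i) (s (i + 1)) := by
  induction k generalizing a with
  | zero => exact ⟨fun _ => a, rfl, fun _ _ => ⟨h, le_rfl⟩, fun i hi => by omega⟩
  | succ k ih =>
    obtain ⟨a', h1, h2, h3⟩ := h
    obtain ⟨s, h4, h5, h6⟩ := ih h3
    have e : Function.update s (k + 1) a (k + 1) = a := Function.update_self ..
    have e' : ∀ i ≤ k, Function.update s (k + 1) a i = s i := fun i hi =>
      Function.update_of_ne (by omega) ..
    refine ⟨Function.update s (k + 1) a, e, fun i hi => ?_, fun i hi => ?_⟩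
    · rcases Nat.le_succ_iff.1 hi with h7 | h7
      · rw [e' i h7]
        have := h5 i h7
        omega
      · rw [show i = k + 1 from h7, e]
        have := h5 0 (by omega)
        omega
    · rcases Nat.lt_succ_iff_lt_or_eq.1 hi with h7 | h7
      · rw [e' i h7.le, e' (i + 1) h7]
        exact h6 i h7
      · subst h7
        rw [e, e' i le_rfl, h4]
        exact ⟨h1, h2⟩

theorem exists_label {ρ : ℕ → ℕ → Prop} {n r : ℕ}
    (h : ∀ a, a ≤ n → ¬ EndsChain ρ r a) : ∃ I : ℕ → ℕ,
      (∀ a, 1 ≤ a → a ≤ n → I a < r) ∧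
      ∀ a' a, 1 ≤ a' → a' < a → a ≤ n → ρ a' a → I a' < I a := by
  classical
  have spec : ∀ a, 1 ≤ a → EndsChain ρ (Nat.findGreatest (fun k => EndsChain ρ k a) r) a :=
    fun a ha => Nat.findGreatest_spec (P := fun k => EndsChain ρ k a) (Nat.zero_le r) ha
  have lt : ∀ a, 1 ≤ a → a ≤ n → Nat.findGreatest (fun k => EndsChain ρ k a) r < r := by
    intro a h1 h2
    refine lt_of_le_of_ne (Nat.findGreatest_le r) fun e => h a h2 ?_
    have := spec a h1
    rwa [e] at this
  refine ⟨fun a => Nat.findGreatest (fun k => EndsChain ρ k a) r, lt, ?_⟩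
  intro a' a h1 h2 h3 h4
  exact Nat.le_findGreatest (P := fun k => EndsChain ρ k a) (lt a' h1 (by omega))
    ⟨a', h2, h4, spec a' h1⟩

/-- The involution `f` matches the entries of `P` with the shifted entries of the row-reversal
of `Q`. -/
def Matches (r c : ℕ) (P Q : ℕ → ℕ → ℕ) (f : ℕ → ℕ) : Prop :=
  ∀ i k, i < r → k < c →
    f (P i k) = r * c + Q i (c - 1 - k) ∧ f (r * c + Q i (c - 1 - k)) = P i k

section

variable {r c : ℕ} {P Q : ℕ → ℕ → ℕ} {f : ℕ → ℕ}

theorem matches_promPerm (hP : IsSYT r c P) (hQ : IsSYT r c Q) :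
    Matches r c P Q (promPerm (2 * r) c (stack r c P Q) r) := by
  intro i k hi hk
  have h1 := (promPerm_stack hP hQ hi (k := c - 1 - k) (by omega)).1
  rw [show c - 1 - (c - 1 - k) = k by omega] at h1
  exact ⟨h1, (promPerm_stack hP hQ hi hk).2⟩

theorem exists_cell (hP : IsSYT r c P) (hQ : IsSYT r c Q) {j : ℕ}
    (hj : j ∈ Set.Icc 1 (2 * (r * c))) :
    ∃ i k, i < r ∧ k < c ∧ (j = P i k ∨ j = r * c + Q i (c - 1 - k)) := by
  obtain ⟨h1, h2⟩ := hj
  rcases le_or_gt j (r * c) with h | h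
  · obtain ⟨i, k, hi, hk, e⟩ := hP.isG.surj (a := j) (by omega) (by omega)
    exact ⟨i, k, hi, hk, Or.inl e.symm⟩
  · obtain ⟨i, k, hi, hk, e⟩ := hQ.isG.surj (a := j - r * c) (by omega) (by omega)
    refine ⟨i, c - 1 - k, hi, by omega, Or.inr ?_⟩
    rw [show c - 1 - (c - 1 - k) = k by omega]
    omega

theorem eq_promPerm_iff (hP : IsSYT r c P) (hQ : IsSYT r c Q) :
    (∀ j ∈ Set.Icc 1 (2 * (r * c)), f j = promPerm (2 * r) c (stack r c P Q) r j) ↔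
      Matches r c P Q f := by
  have hm := matches_promPerm hP hQ
  constructor
  · intro h i k hi hk
    have hk' : c - 1 - k < c := by omega
    have h1 := hP.isG.lo hi hk
    have h2 := hP.isG.hi hi hk
    have h3 := hQ.isG.lo hi hk'
    have h4 := hQ.isG.hi hi hk'
    rw [h _ ⟨by omega, by omega⟩, h _ ⟨by omega, by omega⟩]
    exact hm i k hi hk
  · intro h j hj
    obtain ⟨i, k, hi, hk, rfl | rfl⟩ := exists_cell hP hQ hj
    · rw [(h i k hi hk).1, (hm i k hi hk).1]
    · rw [(h i k hi hk).2, (hm i k hi hk).2]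

theorem Matches.exists_top (h : Matches r c P Q f) (hP : IsSYT r c P) (hQ : IsSYT r c Q) {a : ℕ}
    (h1 : 1 ≤ a) (h2 : f a ≤ 2 * (r * c)) (h3 : a < f a) :
    ∃ i k, i < r ∧ k < c ∧ a = P i k ∧ f a = r * c + Q i (c - 1 - k) := by
  obtain ⟨i, k, hi, hk, e | e⟩ := exists_cell hP hQ (j := a) ⟨h1, by omega⟩
  · exact ⟨i, k, hi, hk, e, by rw [e, (h i k hi hk).1]⟩
  · exfalso
    have := hP.isG.hi hi hk
    have := hQ.isG.lo hi (show c - 1 - k < c by omega)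
    have := (h i k hi hk).2
    rw [← e] at this
    omega

theorem Matches.properties (h : Matches r c P Q f) (hr : 1 ≤ r) (hc : 1 ≤ c) (hP : IsSYT r c P)
    (hQ : IsSYT r c Q) :
    (Set.BijOn f (Set.Icc 1 (2 * (r * c))) (Set.Icc 1 (2 * (r * c))) ∧
      (∀ a ∈ Set.Icc 1 (2 * (r * c)), f (f a) = a ∧ f a ≠ a) ∧
      (∀ a ∈ Set.Icc 1 (r * c), r * c + 1 ≤ f a ∧ f a ≤ 2 * (r * c)) ∧
      (HasCrossing f (2 * (r * c)) r ∧ ¬ HasCrossing f (2 * (r * c)) (r + 1)) ∧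
      (HasNesting f (2 * (r * c)) c ∧ ¬ HasNesting f (2 * (r * c)) (c + 1))) := by
  have hP' := hP.isG
  have hQ' := hQ.isG
  have bounds : ∀ i k, i < r → k < c → 1 ≤ P i k ∧ P i k ≤ r * c ∧
      1 ≤ Q i (c - 1 - k) ∧ Q i (c - 1 - k) ≤ r * c := by
    intro i k hi hk
    have hk' : c - 1 - k < c := by omega
    have h1 := hP'.lo hi hk
    have h2 := hP'.hi hi hk
    have h3 := hQ'.lo hi hk'
    have h4 := hQ'.hi hi hk'
    omega
  have hmaps : Set.MapsTo f (Set.Icc 1 (2 * (r * c))) (Set.Icc 1 (2 * (r * c))) := by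
    intro a ha
    obtain ⟨i, k, hi, hk, rfl | rfl⟩ := exists_cell hP hQ ha
    · rw [(h i k hi hk).1]
      have := bounds i k hi hk
      exact ⟨by omega, by omega⟩
    · rw [(h i k hi hk).2]
      have := bounds i k hi hk
      exact ⟨by omega, by omega⟩
  have hinv : ∀ a ∈ Set.Icc 1 (2 * (r * c)), f (f a) = a ∧ f a ≠ a := by
    intro a ha
    obtain ⟨i, k, hi, hk, rfl | rfl⟩ := exists_cell hP hQ ha
    · rw [(h i k hi hk).1, (h i k hi hk).2]
      have := bounds i k hi hk
      exact ⟨rfl, by omega⟩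
    · rw [(h i k hi hk).2, (h i k hi hk).1]
      have := bounds i k hi hk
      exact ⟨rfl, by omega⟩
  have hinv' : Set.InvOn f f (Set.Icc 1 (2 * (r * c))) (Set.Icc 1 (2 * (r * c))) :=
    ⟨fun a ha => (hinv a ha).1, fun a ha => (hinv a ha).1⟩
  refine ⟨hinv'.bijOn hmaps hmaps, hinv, ?_, ⟨?_, ?_⟩, ?_, ?_⟩
  · rintro a ⟨h1, h2⟩
    obtain ⟨i, k, hi, hk, e⟩ := hP'.surj (a := a) (by omega) (by omega)
    rw [← e, (h i k hi hk).1]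
    have := bounds i k hi hk
    omega
  · refine ⟨fun m => P m 0, fun m => r * c + Q m (c - 1 - 0), fun m m' hm => ?_, fun m m' hm => ?_,
      fun m => ?_, fun m m' => ?_⟩
    · exact hP'.lt hm.le le_rfl m'.2 hc (by have : (m : ℕ) < m' := hm; omega)
    · exact Nat.add_lt_add_left (hQ'.lt hm.le le_rfl m'.2 (by omega)
        (by have : (m : ℕ) < m' := hm; omega)) _
    · have := bounds m 0 m.2 hc
      have := (h m 0 m.2 hc).1
      refine ⟨?_, ?_, this, ?_⟩ <;> beta_reduce <;> omega
    · have := bounds m 0 m.2 hc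
      have := bounds m' 0 m'.2 hc
      beta_reduce
      omega
  · rintro ⟨a, b, ha, hb, hab, -⟩
    have : ∀ m, ∃ p : Fin r × ℕ, p.2 < c ∧ a m = P p.1 p.2 ∧ b m = r * c + Q p.1 (c - 1 - p.2) := by
      intro m
      obtain ⟨h1, h2, h3, h4⟩ := hab m
      obtain ⟨i, k, hi, hk, e1, e2⟩ := h.exists_top hP hQ h1 (by omega) (by omega)
      exact ⟨(⟨i, hi⟩, k), hk, e1, by rw [← h3, e2]⟩
    choose p hp1 hp2 hp3 using this
    obtain ⟨m, m', hmm, e⟩ : ∃ m m' : Fin (r + 1), m < m' ∧ (p m).1 = (p m').1 := by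
      obtain ⟨x, y, hxy, e⟩ := Fintype.exists_ne_map_eq_of_card_lt (fun m => (p m).1) (by simp)
      rcases lt_or_gt_of_ne hxy with h1 | h1
      · exact ⟨x, y, h1, e⟩
      · exact ⟨y, x, h1, e.symm⟩
    have h1 := ha hmm
    have h2 := hb hmm
    rw [hp2, hp2, e] at h1
    rw [hp3, hp3, e] at h2
    have h3 : (p m).2 < (p m').2 := by
      by_contra hcon
      have := hP'.le le_rfl (not_lt.1 hcon) (p m').1.2 (hp1 m)
      omega
    have := hQ'.le (i := (p m').1) (i' := (p m').1) le_rfl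
      (show c - 1 - (p m').2 ≤ c - 1 - (p m).2 by omega) (p m').1.2 (by omega)
    omega
  · refine ⟨fun m => P 0 m, fun m => r * c + Q 0 (c - 1 - m), fun m m' hm => ?_, fun m m' hm => ?_,
      fun m => ?_, fun m m' => ?_⟩
    · exact hP'.lt le_rfl hm.le hr m'.2 (by have : (m : ℕ) < m' := hm; omega)
    · have : (m : ℕ) < m' := hm
      have := m'.2
      exact Nat.add_lt_add_left (hQ'.lt le_rfl (by omega) hr (by omega) (by omega)) _
    · have := bounds 0 m hr m.2
      have := (h 0 m hr m.2).1
      refine ⟨?_, ?_, this, ?_⟩ <;> beta_reduce <;> omega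
    · have := bounds 0 m hr m.2
      have := bounds 0 m' hr m'.2
      beta_reduce
      omega
  · rintro ⟨a, b, ha, hb, hab, -⟩
    have : ∀ m, ∃ p : ℕ × Fin c, p.1 < r ∧ a m = P p.1 p.2 ∧ b m = r * c + Q p.1 (c - 1 - p.2) := by
      intro m
      obtain ⟨h1, h2, h3, h4⟩ := hab m
      obtain ⟨i, k, hi, hk, e1, e2⟩ := h.exists_top hP hQ h1 (by omega) (by omega)
      exact ⟨(i, ⟨k, hk⟩), hi, e1, by rw [← h3, e2]⟩
    choose p hp1 hp2 hp3 using this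
    obtain ⟨m, m', hmm, e⟩ : ∃ m m' : Fin (c + 1), m < m' ∧ (p m).2 = (p m').2 := by
      obtain ⟨x, y, hxy, e⟩ := Fintype.exists_ne_map_eq_of_card_lt (fun m => (p m).2) (by simp)
      rcases lt_or_gt_of_ne hxy with h1 | h1
      · exact ⟨x, y, h1, e⟩
      · exact ⟨y, x, h1, e.symm⟩
    have h1 := ha hmm
    have h2 := hb hmm
    rw [hp2, hp2, e] at h1
    rw [hp3, hp3, e] at h2
    have h3 : (p m).1 < (p m').1 := by
      by_contra hcon
      have := hP'.le (not_lt.1 hcon) le_rfl (hp1 m) (p m').2.2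
      omega
    have := hQ'.le h3.le (le_refl (c - 1 - ((p m').2 : ℕ))) (hp1 m') (by omega)
    omega

theorem exists_matches (hinv : ∀ a ∈ Set.Icc 1 (2 * (r * c)), f (f a) = a ∧ f a ≠ a)
    (hf : ∀ a ∈ Set.Icc 1 (r * c), r * c + 1 ≤ f a ∧ f a ≤ 2 * (r * c))
    (hcr : ¬ HasCrossing f (2 * (r * c)) (r + 1)) (hne : ¬ HasNesting f (2 * (r * c)) (c + 1)) :
    ∃ P Q : ℕ → ℕ → ℕ, IsSYT r c P ∧ IsSYT r c Q ∧ Matches r c P Q f := by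
  have finj : ∀ a b, 1 ≤ a → a ≤ r * c → 1 ≤ b → b ≤ r * c → f a = f b → a = b := by
    intro a b h1 h2 h3 h4 e
    rw [← (hinv a ⟨h1, by omega⟩).1, e, (hinv b ⟨h3, by omega⟩).1]
  have seq : ∀ {ρ : ℕ → ℕ → Prop} {k a : ℕ}, a ≤ r * c → EndsChain ρ k a →
      ∃ s : Fin (k + 1) → ℕ, StrictMono s ∧ (∀ i : Fin k, ρ (s i.castSucc) (s i.succ)) ∧
        (∀ m, 1 ≤ s m ∧ f (s m) ≤ 2 * (r * c) ∧ f (s m) = f (s m) ∧ s m < f (s m)) ∧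
        ∀ m m', s m < f (s m') := by
    intro ρ k a ha h
    obtain ⟨s, -, h2, h3⟩ := h.exists_seq
    refine ⟨fun i => s i, Fin.strictMono_iff_lt_succ.2 fun i => (h3 i i.2).1,
      fun i => (h3 i i.2).2, fun m => ?_, fun m m' => ?_⟩
    · have h4 := h2 m (by omega)
      have := hf (s m) ⟨h4.1, h4.2.trans ha⟩
      exact ⟨h4.1, this.2, rfl, by beta_reduce; omega⟩
    · have h4 := h2 m (by omega)
      have h5 := h2 m' (by omega)
      have := hf (s m') ⟨h5.1, h5.2.trans ha⟩
      beta_reduce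
      omega
  obtain ⟨I, hI1, hI2⟩ := exists_label (ρ := fun x y => f x < f y) (n := r * c) (r := r)
    fun a ha h => by
      obtain ⟨s, h1, h2, h3, h4⟩ := seq ha h
      exact hcr ⟨s, fun m => f (s m), h1, Fin.strictMono_iff_lt_succ.2 h2, h3, h4⟩
  obtain ⟨D, hD1, hD2⟩ := exists_label (ρ := fun x y => f y < f x) (n := r * c) (r := c)
    fun a ha h => by
      obtain ⟨s, h1, h2, h3, h4⟩ := seq ha h
      exact hne ⟨s, fun m => f (s m), h1, Fin.strictAnti_iff_succ_lt.2 h2, h3, h4⟩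
  have sep : ∀ a' a, 1 ≤ a' → a' < a → a ≤ r * c →
      (f a' < f a ∧ I a' < I a) ∨ (f a < f a' ∧ D a' < D a) := by
    intro a' a h1 h2 h3
    rcases lt_trichotomy (f a') (f a) with h | h | h
    · exact Or.inl ⟨h, hI2 a' a h1 h2 h3 h⟩
    · have := finj a' a h1 (by omega) (by omega) h3 h
      omega
    · exact Or.inr ⟨h, hD2 a' a h1 h2 h3 h⟩
  have hsurj : ∀ i j, i < r → j < c → ∃ a, 1 ≤ a ∧ a ≤ r * c ∧ I a = i ∧ D a = j := by
    have : Set.SurjOn (fun a => (I a, D a)) (Finset.Icc 1 (r * c) : Finset ℕ)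
        (Finset.range r ×ˢ Finset.range c : Finset (ℕ × ℕ)) := by
      refine Finset.surjOn_of_injOn_of_card_le _ ?_ ?_ (by simp)
      · intro a ha
        simp only [Finset.coe_Icc, Set.mem_Icc] at ha
        simpa using ⟨hI1 a ha.1 ha.2, hD1 a ha.1 ha.2⟩
      · intro a ha b hb e
        simp only [Finset.coe_Icc, Set.mem_Icc] at ha hb
        have e1 := congrArg Prod.fst e
        have e2 := congrArg Prod.snd e
        simp only at e1 e2
        rcases lt_trichotomy a b with h | h | h
        · have := sep a b ha.1 h hb.2
          omega
        · exact h
        · have := sep b a hb.1 h ha.2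
          omega
    intro i j hi hj
    obtain ⟨a, ha, e⟩ := this (show (i, j) ∈ _ by simp [hi, hj])
    simp only [Finset.coe_Icc, Set.mem_Icc] at ha
    exact ⟨a, ha.1, ha.2, congrArg Prod.fst e, congrArg Prod.snd e⟩
  have : ∀ i j, ∃ a, i < r → j < c → 1 ≤ a ∧ a ≤ r * c ∧ I a = i ∧ D a = j := by
    intro i j
    by_cases h : i < r ∧ j < c
    · obtain ⟨a, ha⟩ := hsurj i j h.1 h.2
      exact ⟨a, fun _ _ => ha⟩
    · exact ⟨0, fun h1 h2 => absurd ⟨h1, h2⟩ h⟩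
  choose P hP using this
  have hrow : ∀ i j, i < r → j + 1 < c → P i j < P i (j + 1) ∧ f (P i (j + 1)) < f (P i j) := by
    intro i j hi hj
    obtain ⟨h1, h2, h3, h4⟩ := hP i j hi (by omega)
    obtain ⟨h5, h6, h7, h8⟩ := hP i (j + 1) hi hj
    rcases lt_trichotomy (P i j) (P i (j + 1)) with h | h | h
    · have := sep _ _ h1 h h6
      omega
    · rw [h] at h4
      omega
    · have := sep _ _ h5 h h2
      omega
  have hcol : ∀ i j, i + 1 < r → j < c → P i j < P (i + 1) j ∧ f (P i j) < f (P (i + 1) j) := by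
    intro i j hi hj
    obtain ⟨h1, h2, h3, h4⟩ := hP i j (by omega) hj
    obtain ⟨h5, h6, h7, h8⟩ := hP (i + 1) j hi hj
    rcases lt_trichotomy (P i j) (P (i + 1) j) with h | h | h
    · have := sep _ _ h1 h h6
      omega
    · rw [h] at h3
      omega
    · have := sep _ _ h5 h h2
      omega
  have hPI : ∀ a, 1 ≤ a → a ≤ r * c → P (I a) (D a) = a := by
    intro a h1 h2
    obtain ⟨h5, h6, h7, h8⟩ := hP (I a) (D a) (hI1 a h1 h2) (hD1 a h1 h2)
    rcases lt_trichotomy (P (I a) (D a)) a with h | h | h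
    · have := sep _ _ h5 h h2
      omega
    · exact h
    · have := sep _ _ h1 h h6
      omega
  have hQ : ∀ i j, i < r → j < c → r * c + 1 ≤ f (P i j) ∧ f (P i j) ≤ 2 * (r * c) := by
    intro i j hi hj
    obtain ⟨h1, h2, -⟩ := hP i j hi hj
    exact hf _ ⟨h1, h2⟩
  have fsurj : ∀ b, r * c + 1 ≤ b → b ≤ 2 * (r * c) → ∃ a, 1 ≤ a ∧ a ≤ r * c ∧ f a = b := by
    have : Set.SurjOn f (Finset.Icc 1 (r * c) : Finset ℕ)
        (Finset.Icc (r * c + 1) (2 * (r * c)) : Finset ℕ) := by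
      refine Finset.surjOn_of_injOn_of_card_le _ ?_ ?_ (by simp only [Nat.card_Icc]; omega)
      · intro a ha
        simp only [Finset.coe_Icc] at ha ⊢
        exact hf a ha
      · intro a ha b hb e
        simp only [Finset.coe_Icc, Set.mem_Icc] at ha hb
        exact finj a b ha.1 ha.2 hb.1 hb.2 e
    intro b h1 h2
    obtain ⟨a, ha, e⟩ := this (show b ∈ _ by simp; omega)
    simp only [Finset.coe_Icc, Set.mem_Icc] at ha
    exact ⟨a, ha.1, ha.2, e⟩
  refine ⟨P, fun i j => f (P i (c - 1 - j)) - r * c,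
    ⟨fun i j hi hj => (hrow i j hi hj).1, fun i j hi hj => (hcol i j hi hj).1, ?_, ?_, ?_⟩,
    ⟨fun i j hi hj => ?_, fun i j hi hj => ?_, ?_, ?_, ?_⟩, fun i k hi hk => ?_⟩
  · rintro ⟨i, j⟩ ⟨hi, hj⟩
    exact ⟨(hP i j hi hj).1, (hP i j hi hj).2.1⟩
  · rintro ⟨i, j⟩ ⟨hi, hj⟩ ⟨i', j'⟩ ⟨hi', hj'⟩ e
    obtain ⟨-, -, h3, h4⟩ := hP i j hi hj
    obtain ⟨-, -, h7, h8⟩ := hP i' j' hi' hj'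
    simp only at e
    rw [e] at h3 h4
    exact Prod.ext (h3.symm.trans h7) (h4.symm.trans h8)
  · rintro a ⟨h1, h2⟩
    exact ⟨(I a, D a), ⟨hI1 a h1 h2, hD1 a h1 h2⟩, hPI a h1 h2⟩
  · have h1 := hrow i (c - 1 - (j + 1)) hi (by omega)
    rw [show c - 1 - (j + 1) + 1 = c - 1 - j by omega] at h1
    have h2 := hQ i (c - 1 - j) hi (by omega)
    simp only
    omega
  · have h1 := hcol i (c - 1 - j) hi (by omega)
    have h2 := hQ i (c - 1 - j) (by omega) (by omega)
    simp only
    omega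
  · rintro ⟨i, j⟩ ⟨hi, hj⟩
    change i < r at hi
    change j < c at hj
    have h2 := hQ i (c - 1 - j) hi (by omega)
    simp only [Set.mem_Icc]
    omega
  · rintro ⟨i, j⟩ ⟨hi, hj⟩ ⟨i', j'⟩ ⟨hi', hj'⟩ e
    change i < r at hi
    change j < c at hj
    change i' < r at hi'
    change j' < c at hj'
    simp only at e
    have h2 := hQ i (c - 1 - j) hi (by omega)
    have h2' := hQ i' (c - 1 - j') hi' (by omega)
    obtain ⟨h5, h6, h3, h4⟩ := hP i (c - 1 - j) hi (by omega)
    obtain ⟨h9, h10, h7, h8⟩ := hP i' (c - 1 - j') hi' (by omega)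
    have e' := finj _ _ h5 h6 h9 h10 (by omega)
    rw [e'] at h3 h4
    exact Prod.ext (h3.symm.trans h7) (by simp only; omega)
  · rintro b ⟨h1, h2⟩
    obtain ⟨a, h3, h4, h5⟩ := fsurj (r * c + b) (by omega) (by omega)
    have h6 := hD1 a h3 h4
    refine ⟨(I a, c - 1 - D a), ⟨hI1 a h3 h4, by simp only; omega⟩, ?_⟩
    simp only
    rw [show c - 1 - (c - 1 - D a) = D a by omega, hPI a h3 h4]
    omega
  · simp only
    rw [show c - 1 - (c - 1 - k) = k by omega]
    have h1 := hQ i k hi hk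
    obtain ⟨h2, h3, -⟩ := hP i k hi hk
    rw [show r * c + (f (P i k) - r * c) = f (P i k) by omega]
    exact ⟨rfl, (hinv _ ⟨h2, by omega⟩).1⟩

end

/-- The image of `SYT^stacked(2r × c) → S_{2n}`, `S ↦ prom_r(S)`, is
precisely the set of fixed-point-free involutions `ρ` of `{1, …, 2n}` each of whose
2-cycles `(a b)` has `a ∈ {1, …, n}` and `b ∈ {n+1, …, 2n}`, with crossing number `r`
and nesting number `c`. -/
theorem promPerm_stack_image (r c : ℕ) (hr : 1 ≤ r) (hc : 1 ≤ c) (f : ℕ → ℕ) :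
    (∃ P Q : ℕ → ℕ → ℕ, IsSYT r c P ∧ IsSYT r c Q ∧
      ∀ j ∈ Set.Icc 1 (2 * (r * c)), f j = promPerm (2 * r) c (stack r c P Q) r j) ↔
    (Set.BijOn f (Set.Icc 1 (2 * (r * c))) (Set.Icc 1 (2 * (r * c))) ∧
      (∀ a ∈ Set.Icc 1 (2 * (r * c)), f (f a) = a ∧ f a ≠ a) ∧
      (∀ a ∈ Set.Icc 1 (r * c), r * c + 1 ≤ f a ∧ f a ≤ 2 * (r * c)) ∧
      (HasCrossing f (2 * (r * c)) r ∧ ¬ HasCrossing f (2 * (r * c)) (r + 1)) ∧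
      (HasNesting f (2 * (r * c)) c ∧ ¬ HasNesting f (2 * (r * c)) (c + 1))) := by
  constructor
  · rintro ⟨P, Q, hP, hQ, h⟩
    exact ((eq_promPerm_iff hP hQ).1 h).properties hr hc hP hQ
  · rintro ⟨-, hinv, hf, ⟨-, hcr⟩, -, hne⟩
    obtain ⟨P, Q, hP, hQ, h⟩ := exists_matches hinv hf hcr hne
    exact ⟨P, Q, hP, hQ, (eq_promPerm_iff hP hQ).2 h⟩

end PromRS
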